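/- arXiv:quant-ph/0110125 — 2 statements merged into one kernel-verified Lean document; each statement's English description precedes it below -/
import Mathlib

section
/- (Quantum Stein's lemma.) For every ε with 0 < ε < 1, the limit lim_{n→∞} (1/n) log β*_n(ε) exists and equals −D(ρ‖σ). -/
open Matrix Filter
open scoped ComplexOrder

noncomputable section

/-- Functional calculus for a Hermitian matrix: apply `f` to the eigenvalues. -/
def matFun {m : Type*} [Fintype m] [DecidableEq m] (f : ℝ → ℝ) (A : Matrix m m ℂ) :
    Matrix m m ℂ :=
  if hA : A.IsHermitian then
    (hA.eigenvectorUnitary : Matrix m m ℂ) *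
      Matrix.diagonal (fun i => (f (hA.eigenvalues i) : ℂ)) *
      star (hA.eigenvectorUnitary : Matrix m m ℂ)
  else 0

/-- Matrix logarithm (via functional calculus). -/
def matLog {m : Type*} [Fintype m] [DecidableEq m] (A : Matrix m m ℂ) : Matrix m m ℂ :=
  matFun Real.log A

/-- Real matrix power (via functional calculus). -/
def matRPow {m : Type*} [Fintype m] [DecidableEq m] (A : Matrix m m ℂ) (s : ℝ) :
    Matrix m m ℂ :=
  matFun (fun x => x ^ s) A

open Classical in
/-- The finite set of (distinct, real) eigenvalues of a Hermitian matrix. -/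
def eigFinset {m : Type*} [Fintype m] [DecidableEq m] (A : Matrix m m ℂ) : Finset ℝ :=
  if hA : A.IsHermitian then Finset.image hA.eigenvalues Finset.univ else ∅

/-- `v A`: the number of distinct eigenvalues of a Hermitian matrix `A`. -/
def numEig {m : Type*} [Fintype m] [DecidableEq m] (A : Matrix m m ℂ) : ℕ :=
  (eigFinset A).card

/-- The spectral projection of a Hermitian matrix `A` corresponding to eigenvalue `μ`. -/
def specProj {m : Type*} [Fintype m] [DecidableEq m] (A : Matrix m m ℂ) (μ : ℝ) :
    Matrix m m ℂ :=
  matFun (fun x => if x = μ then 1 else 0) A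

/-- The pinching `E_A(B) = Σ_i E_i B E_i` of `B` by the Hermitian matrix `A`. -/
def pinch {m : Type*} [Fintype m] [DecidableEq m] (A B : Matrix m m ℂ) : Matrix m m ℂ :=
  ∑ μ ∈ eigFinset A, specProj A μ * B * specProj A μ

/-- `{X > 0}`: the projection onto the strictly positive eigenspaces of a Hermitian `X`. -/
def posProj {m : Type*} [Fintype m] [DecidableEq m] (X : Matrix m m ℂ) : Matrix m m ℂ :=
  matFun (fun x => if 0 < x then 1 else 0) X

/-- The `n`-fold tensor (Kronecker) power of a `d × d` matrix, realized on the index type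
`Fin n → Fin d`. -/
def tensorPow {d : ℕ} (ρ : Matrix (Fin d) (Fin d) ℂ) (n : ℕ) :
    Matrix (Fin n → Fin d) (Fin n → Fin d) ℂ :=
  fun x y => ∏ i, ρ (x i) (y i)

/-- A density matrix: positive semidefinite with unit trace. -/
def IsDensity {m : Type*} [Fintype m] [DecidableEq m] (ρ : Matrix m m ℂ) : Prop :=
  ρ.PosSemidef ∧ ρ.trace = 1

/-- A test: an operator `A` with `0 ≤ A ≤ I` in the Loewner order. -/
def IsTest {m : Type*} [Fintype m] [DecidableEq m] (A : Matrix m m ℂ) : Prop :=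
  A.PosSemidef ∧ (1 - A).PosSemidef

/-- The quantum relative entropy `D(ρ‖σ) = Tr[ρ (log ρ − log σ)]`. -/
def relEnt {m : Type*} [Fintype m] [DecidableEq m] (ρ σ : Matrix m m ℂ) : ℝ :=
  ((ρ * (matLog ρ - matLog σ)).trace).re

/-- The error probability of the first kind, `α_n(A) = Tr[ρ_n (I − A)]`. -/
def alphaErr {d : ℕ} (ρ : Matrix (Fin d) (Fin d) ℂ) (n : ℕ)
    (A : Matrix (Fin n → Fin d) (Fin n → Fin d) ℂ) : ℝ :=
  ((tensorPow ρ n * (1 - A)).trace).re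

/-- The error probability of the second kind, `β_n(A) = Tr[σ_n A]`. -/
def betaErr {d : ℕ} (σ : Matrix (Fin d) (Fin d) ℂ) (n : ℕ)
    (A : Matrix (Fin n → Fin d) (Fin n → Fin d) ℂ) : ℝ :=
  ((tensorPow σ n * A).trace).re

/-- `β*_n(ε)`: the minimum type-II error among tests with type-I error at most `ε`. -/
def betaStar {d : ℕ} (ρ σ : Matrix (Fin d) (Fin d) ℂ) (n : ℕ) (ε : ℝ) : ℝ :=
  sInf {b : ℝ | ∃ A : Matrix (Fin n → Fin d) (Fin n → Fin d) ℂ,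
    IsTest A ∧ alphaErr ρ n A ≤ ε ∧ b = betaErr σ n A}


/-- Weak law of large numbers: moments. -/
theorem wlln_moments {ι : Type*} [Fintype ι] (p g : ι → ℝ) (hp : ∑ a, p a = 1)
    (hg : ∑ a, p a * g a = 0) (n : ℕ) :
    (∑ z : Fin n → ι, ∏ i, p (z i)) = 1 ∧
    (∑ z : Fin n → ι, (∏ i, p (z i)) * ∑ i, g (z i)) = 0 ∧
    (∑ z : Fin n → ι, (∏ i, p (z i)) * (∑ i, g (z i)) ^ 2) = n * ∑ a, p a * g a ^ 2 := by
  induction n with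
  | zero => simp
  | succ n ih =>
    obtain ⟨h1, h2, h3⟩ := ih
    refine ⟨?_, ?_, ?_⟩
    · rw [← (Fin.consEquiv (fun _ => ι)).sum_comp, Fintype.sum_prod_type]
      simp [Fin.prod_univ_succ, ← Finset.mul_sum, h1, hp]
    · rw [← (Fin.consEquiv (fun _ => ι)).sum_comp, Fintype.sum_prod_type]
      have : ∀ a : ι, ∀ z : Fin n → ι, p a * (∏ i, p (z i)) * (g a + ∑ i, g (z i))
        = (p a * g a) * (∏ i, p (z i)) + p a * ((∏ i, p (z i)) * ∑ i, g (z i)) := by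
        intros; ring
      simp [Fin.prod_univ_succ, Fin.sum_univ_succ, this, Finset.sum_add_distrib,
        ← Finset.mul_sum, h1, h2, hg]
    · rw [← (Fin.consEquiv (fun _ => ι)).sum_comp, Fintype.sum_prod_type]
      have : ∀ a : ι, ∀ z : Fin n → ι, p a * (∏ i, p (z i)) * (g a + ∑ i, g (z i)) ^ 2
        = (p a * g a ^ 2) * (∏ i, p (z i)) + (2 * (p a * g a)) * ((∏ i, p (z i)) * ∑ i, g (z i))
          + p a * ((∏ i, p (z i)) * (∑ i, g (z i)) ^ 2) := by
        intros; ring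
      simp [Fin.prod_univ_succ, Fin.sum_univ_succ, this, Finset.sum_add_distrib,
        ← Finset.mul_sum, ← Finset.sum_mul, h1, h2, h3, hp]
      ring

open Classical in
/-- The set of typical sequences. -/
def typSet {ι : Type*} [Fintype ι] (f : ι → ℝ) (μ δ : ℝ) (n : ℕ) : Finset (Fin n → ι) :=
  Finset.univ.filter (fun z => |∑ i, f (z i) - n * μ| ≤ n * δ)

theorem wlln {ι : Type*} [Fintype ι] [DecidableEq ι] (p f : ι → ℝ) (hp0 : ∀ a, 0 ≤ p a)
    (hp : ∑ a, p a = 1) (δ η : ℝ) (hδ : 0 < δ) (hη : 0 < η) :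
    ∀ᶠ n : ℕ in atTop, ∑ z ∈ (typSet f (∑ a, p a * f a) δ n)ᶜ, ∏ i, p (z i) ≤ η := by
  set μ := ∑ a, p a * f a with hμ
  set v := ∑ a, p a * (f a - μ) ^ 2 with hv
  have hg : ∑ a, p a * (f a - μ) = 0 := by
    simp [mul_sub, Finset.sum_sub_distrib, ← Finset.sum_mul, hp, ← hμ]
  obtain ⟨N, hN⟩ := exists_nat_gt (v / (δ ^ 2 * η))
  filter_upwards [eventually_ge_atTop (N + 1)] with n hn
  have hnpos : (0:ℝ) < n := by
    have : 0 < n := by omega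
    exact_mod_cast this
  have hNn : (N : ℝ) ≤ n := by exact_mod_cast (by omega : N ≤ n)
  have h3 := (wlln_moments p (fun a => f a - μ) hp hg n).2.2
  rw [← hv] at h3
  have key : (n * δ) ^ 2 * ∑ z ∈ (typSet f μ δ n)ᶜ, ∏ i, p (z i) ≤ n * v := by
    rw [← h3, Finset.mul_sum]
    refine le_trans (Finset.sum_le_sum ?_) (Finset.sum_le_univ_sum_of_nonneg
      (fun z => mul_nonneg (Finset.prod_nonneg fun i _ => hp0 _) (sq_nonneg _)))
    intro z hz
    rw [mul_comm]
    refine mul_le_mul_of_nonneg_left ?_ (Finset.prod_nonneg fun i _ => hp0 _)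
    simp only [typSet, Finset.mem_compl, Finset.mem_filter, Finset.mem_univ, true_and,
      not_le] at hz
    have : ∑ i, (f (z i) - μ) = ∑ i, f (z i) - n * μ := by
      simp [Finset.sum_sub_distrib]
    rw [this, ← sq_abs (∑ i, f (z i) - n * μ)]
    exact pow_le_pow_left₀ (by positivity) hz.le 2
  have h4 : v < n * (δ ^ 2 * η) := by
    rw [div_lt_iff₀ (by positivity)] at hN
    refine lt_of_lt_of_le hN ?_
    gcongr
  have h5 : (n * δ) ^ 2 * ∑ z ∈ (typSet f μ δ n)ᶜ, ∏ i, p (z i) ≤ (n * δ) ^ 2 * η := by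
    refine key.trans ?_
    have := mul_le_mul_of_nonneg_left h4.le hnpos.le
    nlinarith
  exact le_of_mul_le_mul_left h5 (by positivity)

theorem tensorPow_mul {d : ℕ} (A B : Matrix (Fin d) (Fin d) ℂ) (n : ℕ) :
    tensorPow (A * B) n = tensorPow A n * tensorPow B n := by
  ext x y
  simp only [tensorPow, Matrix.mul_apply, ← Finset.prod_mul_distrib]
  rw [Finset.prod_univ_sum, Fintype.piFinset_univ]

theorem tensorPow_star {d : ℕ} (A : Matrix (Fin d) (Fin d) ℂ) (n : ℕ) :
    tensorPow Aᴴ n = (tensorPow A n)ᴴ := by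
  ext x y
  simp [tensorPow, Matrix.conjTranspose_apply]

theorem tensorPow_diagonal {d : ℕ} (f : Fin d → ℂ) (n : ℕ) :
    tensorPow (Matrix.diagonal f) n = Matrix.diagonal (fun x => ∏ i, f (x i)) := by
  ext x y
  by_cases h : x = y
  · subst h; simp [tensorPow]
  · obtain ⟨i, hi⟩ := Function.ne_iff.mp h
    simp only [tensorPow, Matrix.diagonal_apply_ne _ h]
    exact Finset.prod_eq_zero (Finset.mem_univ i) (Matrix.diagonal_apply_ne _ hi)

theorem tensorPow_one {d : ℕ} (n : ℕ) :
    tensorPow (1 : Matrix (Fin d) (Fin d) ℂ) n = 1 := by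
  rw [← Matrix.diagonal_one, tensorPow_diagonal]
  simp

section OneShot

set_option linter.unusedSectionVars false

variable {m : Type*} [Fintype m] [DecidableEq m]

theorem diag_posSemidef (f : m → ℝ) (hf : ∀ x, 0 ≤ f x) :
    (Matrix.diagonal (fun x => (f x : ℂ))).PosSemidef := by
  rw [Matrix.posSemidef_diagonal_iff]
  intro i
  exact_mod_cast hf i

/-- Spectral form. -/
def spec (U : Matrix m m ℂ) (f : m → ℝ) : Matrix m m ℂ :=
  U * Matrix.diagonal (fun x => (f x : ℂ)) * Uᴴ

theorem spec_posSemidef (U : Matrix m m ℂ) (f : m → ℝ) (hf : ∀ x, 0 ≤ f x) :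
    (spec U f).PosSemidef :=
  (diag_posSemidef f hf).mul_mul_conjTranspose_same U

theorem spec_mul (U : Matrix m m ℂ) (hU : Uᴴ * U = 1) (f g : m → ℝ) :
    spec U f * spec U g = spec U (fun x => f x * g x) := by
  unfold spec
  calc _ = U * Matrix.diagonal (fun x => (f x : ℂ)) * (Uᴴ * U) *
        Matrix.diagonal (fun x => (g x : ℂ)) * Uᴴ := by simp only [Matrix.mul_assoc]
    _ = _ := by
      rw [hU, Matrix.mul_one, Matrix.mul_assoc U, Matrix.diagonal_mul_diagonal]
      simp

theorem spec_one (U : Matrix m m ℂ) (hU : U * Uᴴ = 1) : spec U (fun _ => 1) = 1 := by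
  simp [spec, hU]

theorem spec_sub (U : Matrix m m ℂ) (f g : m → ℝ) :
    spec U f - spec U g = spec U (fun x => f x - g x) := by
  unfold spec
  rw [← Matrix.sub_mul, ← Matrix.mul_sub, Matrix.diagonal_sub]
  simp

theorem trace_spec_mul (U : Matrix m m ℂ) (f : m → ℝ) (Z : Matrix m m ℂ) :
    (spec U f * Z).trace.re = ∑ x, f x * ((Uᴴ * Z * U) x x).re := by
  have : (spec U f * Z).trace = (Matrix.diagonal (fun x => (f x : ℂ)) * (Uᴴ * Z * U)).trace := by
    unfold spec
    rw [Matrix.mul_assoc, Matrix.mul_assoc, Matrix.trace_mul_comm]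
    simp only [Matrix.mul_assoc]
  rw [this, Matrix.trace]
  simp [Matrix.diagonal_mul]

theorem spec_conj (U V : Matrix m m ℂ) (g : m → ℝ) :
    Uᴴ * spec V g * U = spec (Uᴴ * V) g := by
  simp [spec, Matrix.conjTranspose_mul, Matrix.mul_assoc]

theorem spec_diag (W : Matrix m m ℂ) (g : m → ℝ) (x : m) :
    ((spec W g) x x).re = ∑ y, Complex.normSq (W x y) * g y := by
  unfold spec
  rw [Matrix.mul_apply]
  simp only [Matrix.mul_diagonal, Matrix.conjTranspose_apply, Complex.re_sum]
  refine Finset.sum_congr rfl fun y _ => ?_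
  simp [Complex.normSq_apply]
  ring

theorem trace_spec_spec (U V : Matrix m m ℂ) (f g : m → ℝ) :
    (spec U f * spec V g).trace.re
      = ∑ x, f x * ∑ y, Complex.normSq ((Uᴴ * V) x y) * g y := by
  rw [trace_spec_mul, spec_conj]
  simp only [spec_diag]

theorem trace_spec_nonneg (U : Matrix m m ℂ) (f : m → ℝ) (hf : ∀ x, 0 ≤ f x)
    (Z : Matrix m m ℂ) (hZ : Z.PosSemidef) : 0 ≤ (spec U f * Z).trace.re := by
  rw [trace_spec_mul]
  refine Finset.sum_nonneg fun x _ => mul_nonneg (hf x) ?_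
  have := (hZ.conjTranspose_mul_mul_same U).diag_nonneg (i := x)
  exact (Complex.le_def.mp this).1

theorem trace_spec_mono (U : Matrix m m ℂ) (f : m → ℝ) (hf : ∀ x, 0 ≤ f x)
    (Z Z' : Matrix m m ℂ) (hZ : (Z' - Z).PosSemidef) :
    (spec U f * Z).trace.re ≤ (spec U f * Z').trace.re := by
  have := trace_spec_nonneg U f hf _ hZ
  rw [Matrix.mul_sub, Matrix.trace_sub, Complex.sub_re] at this
  linarith

theorem test_sq {A : Matrix m m ℂ} (hA : IsTest A) : (A - A * Aᴴ).PosSemidef := by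
  obtain ⟨h0, h1⟩ := hA
  have hh : Aᴴ = A := h0.1
  have hh' : (1 - A)ᴴ = 1 - A := h1.1
  have e1 := h1.conjTranspose_mul_mul_same A
  have e2 := h0.conjTranspose_mul_mul_same (1 - A)
  rw [hh] at e1
  rw [hh'] at e2
  have := e1.add e2
  convert this using 1
  rw [hh]
  noncomm_ring

theorem test_compl {A : Matrix m m ℂ} (hA : IsTest A) : IsTest (1 - A) :=
  ⟨hA.2, by simpa using hA.1⟩

/-- Real indicator of a finset. -/
def ind (X : Finset m) (x : m) : ℝ := if x ∈ X then 1 else 0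

theorem ind_nonneg (X : Finset m) (x : m) : 0 ≤ ind X x := by
  unfold ind; split_ifs <;> norm_num

theorem ind_le_one (X : Finset m) (x : m) : ind X x ≤ 1 := by
  unfold ind; split_ifs <;> norm_num

theorem ind_mul_self (X : Finset m) (x : m) : ind X x * ind X x = ind X x := by
  unfold ind; split_ifs <;> norm_num

theorem one_sub_ind (X : Finset m) (x : m) : 1 - ind X x = ind Xᶜ x := by
  unfold ind
  by_cases h : x ∈ X <;> simp [h]

theorem trace_spec (U : Matrix m m ℂ) (hU : Uᴴ * U = 1) (f : m → ℝ) :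
    (spec U f).trace.re = ∑ x, f x := by
  have := trace_spec_mul U f 1
  rw [Matrix.mul_one] at this
  rw [this]
  simp [hU]

theorem oneShot_direct (U V : Matrix m m ℂ) (hU : Uᴴ * U = 1) (hV : Vᴴ * V = 1)
    (L M : m → ℝ) (hL : ∀ x, 0 ≤ L x) (hL1 : ∑ x, L x = 1)
    (X Y : Finset m) (η a b : ℝ) (ha : 0 < a) (hb : 0 ≤ b)
    (hX : ∑ x ∈ Xᶜ, L x ≤ η)
    (hY : ∑ y ∈ Yᶜ, ∑ x, L x * Complex.normSq ((Uᴴ * V) x y) ≤ η)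
    (hLa : ∀ x ∈ X, a ≤ L x) (hMb : ∀ y ∈ Y, M y ≤ b) :
    ∃ A : Matrix m m ℂ, IsTest A ∧ (spec U L * (1 - A)).trace.re ≤ 5 * η ∧
      (spec V M * A).trace.re ≤ b / a := by
  have hU' : U * Uᴴ = 1 := mul_eq_one_comm.mp hU
  have hV' : V * Vᴴ = 1 := mul_eq_one_comm.mp hV
  set P := spec U (ind X) with hP
  set Q := spec V (ind Y) with hQ
  set R := spec U (ind Xᶜ) with hR
  set T := spec V (ind Yᶜ) with hT
  have hPR : 1 - R = P := by
    rw [← spec_one U hU', hR, spec_sub]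
    simp [one_sub_ind, hP]
  have hQT : 1 - T = Q := by
    rw [← spec_one V hV', hT, spec_sub]
    simp [one_sub_ind, hQ]
  have pP : P.PosSemidef := spec_posSemidef _ _ (ind_nonneg _)
  have pQ : Q.PosSemidef := spec_posSemidef _ _ (ind_nonneg _)
  have pR : R.PosSemidef := spec_posSemidef _ _ (ind_nonneg _)
  have pT : T.PosSemidef := spec_posSemidef _ _ (ind_nonneg _)
  have hTT : T * T = T := by rw [hT, spec_mul V hV]; simp [ind_mul_self]
  have hQh : Qᴴ = Q := pQ.1
  have hTh : Tᴴ = T := pT.1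
  have pA : (Q * P * Q).PosSemidef := by
    have := pP.conjTranspose_mul_mul_same Q
    rwa [hQh] at this
  have pQRQ : (Q * R * Q).PosSemidef := by
    have := pR.conjTranspose_mul_mul_same Q
    rwa [hQh] at this
  have pTPT : (T * P * T).PosSemidef := by
    have := pP.conjTranspose_mul_mul_same T
    rwa [hTh] at this
  have e1A : 1 - Q * P * Q = T + Q * R * Q := by
    rw [← hPR, ← hQT]
    have : 1 - (1 - T) * (1 - R) * (1 - T) = 2 * T - T * T + (1 - T) * R * (1 - T) := by
      noncomm_ring
    rw [this, hTT]
    noncomm_ring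
  refine ⟨Q * P * Q, ⟨pA, ?_⟩, ?_, ?_⟩
  · rw [e1A]; exact pT.add pQRQ
  · have hle : ((R + R + (T + T + T)) - (1 - Q * P * Q)).PosSemidef := by
      have p1 := pR.conjTranspose_mul_mul_same (1 + T)
      have : (1 + T)ᴴ = 1 + T := by simp [hTh]
      rw [this] at p1
      have p2 := (p1.add pTPT).add pTPT
      convert p2 using 1
      rw [e1A, ← hPR, ← hQT]
      have : (1 + T) * R * (1 + T) + T * (1 - R) * T + T * (1 - R) * T =
        R + R + 2 * (T * T) - (1 - T) * R * (1 - T) := by noncomm_ring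
      rw [this, hTT]
      noncomm_ring
    refine (trace_spec_mono U L hL _ _ hle).trans ?_
    have tR : (spec U L * R).trace.re ≤ η := by
      rw [hR, spec_mul U hU, trace_spec U hU]
      refine le_trans (le_of_eq ?_) hX
      simp [ind, -Finset.mem_compl]
    have tT : (spec U L * T).trace.re ≤ η := by
      rw [hT, trace_spec_spec]
      refine le_trans (le_of_eq ?_) hY
      rw [Finset.sum_comm]
      refine Finset.sum_congr rfl fun x _ => ?_
      rw [← Finset.mul_sum]
      simp [ind, -Finset.mem_compl]
    simp only [Matrix.mul_add, Matrix.trace_add, Complex.add_re]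
    linarith
  · have e : (spec V M * (Q * P * Q)).trace.re
        = (spec U (ind X) * spec V (fun y => ind Y y * M y * ind Y y)).trace.re := by
      rw [← spec_mul V hV, ← spec_mul V hV, ← hQ, ← hP]
      congr 1
      calc (spec V M * (Q * P * Q)).trace = (((spec V M * Q) * P) * Q).trace := by
            simp only [Matrix.mul_assoc]
        _ = (Q * (spec V M * Q * P)).trace := Matrix.trace_mul_comm _ _
        _ = ((Q * spec V M * Q) * P).trace := by simp only [Matrix.mul_assoc]
        _ = _ := Matrix.trace_mul_comm _ _
    rw [e]
    have hle : (spec V (fun _ => b) - spec V (fun y => ind Y y * M y * ind Y y)).PosSemidef := by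
      rw [spec_sub]
      refine spec_posSemidef _ _ fun y => ?_
      unfold ind
      split_ifs with h
      · simpa using hMb y h
      · simpa using hb
    refine (trace_spec_mono U _ (ind_nonneg X) _ _ hle).trans ?_
    have e2 : spec V (fun _ => b) = spec U (fun _ => b) := by
      have h1 : ∀ W : Matrix m m ℂ, W * Wᴴ = 1 → spec W (fun _ => b) = (b : ℂ) • 1 := by
        intro W hW
        have : Matrix.diagonal (fun _ : m => (b : ℂ)) = (b : ℂ) • 1 := by
          rw [Matrix.smul_one_eq_diagonal]
        simp [spec, this, hW]
      rw [h1 V hV', h1 U hU']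
    rw [e2, spec_mul U hU, trace_spec U hU, ← Finset.sum_mul, le_div_iff₀ ha]
    have h3 : (∑ x, ind X x) * a ≤ 1 := by
      rw [Finset.sum_mul, ← hL1]
      refine Finset.sum_le_sum fun x _ => ?_
      unfold ind
      split_ifs with h
      · simpa using hLa x h
      · simpa using hL x
    nlinarith

theorem normSq_split (t : ℝ) (ht : 0 < t) (z w : ℂ) :
    Complex.normSq (z + w) ≤ (1 + t) * Complex.normSq z + (1 + 1 / t) * Complex.normSq w := by
  have h : (1 + t) * Complex.normSq z + (1 + 1 / t) * Complex.normSq w - Complex.normSq (z + w)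
      = ((t * z.re - w.re) ^ 2 + (t * z.im - w.im) ^ 2) / t := by
    simp only [Complex.normSq_apply, Complex.add_re, Complex.add_im]
    field_simp
    ring
  have : 0 ≤ ((t * z.re - w.re) ^ 2 + (t * z.im - w.im) ^ 2) / t := by positivity
  linarith

theorem mul_conjTranspose_diag (C : Matrix m m ℂ) (x : m) :
    ((C * Cᴴ) x x).re = ∑ y, Complex.normSq (C x y) := by
  simp [Matrix.mul_apply, Complex.normSq_apply]

theorem trace_row (U V : Matrix m m ℂ) (hV : V * Vᴴ = 1) (f : m → ℝ) (Z : Matrix m m ℂ) :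
    (spec U f * (Z * Zᴴ)).trace.re
      = ∑ x, f x * ∑ y, Complex.normSq ((Uᴴ * Z * V) x y) := by
  rw [trace_spec_mul]
  refine Finset.sum_congr rfl fun x _ => ?_
  rw [← mul_conjTranspose_diag]
  have : Uᴴ * (Z * Zᴴ) * U = Uᴴ * Z * V * (Uᴴ * Z * V)ᴴ := by
    calc Uᴴ * (Z * Zᴴ) * U = Uᴴ * Z * (V * Vᴴ) * Zᴴ * U := by
          rw [hV]; simp only [Matrix.mul_assoc, Matrix.mul_one]
      _ = _ := by
          simp only [Matrix.conjTranspose_mul, Matrix.conjTranspose_conjTranspose,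
            Matrix.mul_assoc]
  rw [this]

theorem oneShot_converse (U V : Matrix m m ℂ) (hU : Uᴴ * U = 1) (hV : Vᴴ * V = 1)
    (L M : m → ℝ) (hL : ∀ x, 0 ≤ L x) (hM : ∀ x, 0 ≤ M x) (hL1 : ∑ x, L x = 1)
    (X Y : Finset m) (η a b ε t : ℝ) (ha : 0 ≤ a) (hb : 0 < b) (ht : 0 < t)
    (hX : ∑ x ∈ Xᶜ, L x ≤ η)
    (hY : ∑ y ∈ Yᶜ, ∑ x, L x * Complex.normSq ((Uᴴ * V) x y) ≤ η)
    (hLa : ∀ x ∈ X, L x ≤ a) (hMb : ∀ y ∈ Y, b ≤ M y)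
    (A : Matrix m m ℂ) (hA : IsTest A) (hα : (spec U L * (1 - A)).trace.re ≤ ε) :
    1 - 2 * η ≤ (1 + t) * ε + (1 + 1 / t) * (a / b * (spec V M * A).trace.re) := by
  have hU' : U * Uᴴ = 1 := mul_eq_one_comm.mp hU
  have hV' : V * Vᴴ = 1 := mul_eq_one_comm.mp hV
  have hAh : Aᴴ = A := hA.1.1
  set W := Uᴴ * V with hW
  set C := Uᴴ * (1 - A) * V with hC
  set B := Uᴴ * A * V with hB
  have hCB : ∀ x y, W x y = C x y + B x y := by
    intro x y
    rw [← Matrix.add_apply, hC, hB, hW]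
    simp [Matrix.mul_sub, Matrix.sub_mul]
  have hrow : ∀ x, ∑ y, Complex.normSq (W x y) = 1 := by
    intro x
    rw [← mul_conjTranspose_diag]
    have : W * Wᴴ = 1 := by
      calc W * Wᴴ = Uᴴ * (V * Vᴴ) * U := by
            simp only [hW, Matrix.conjTranspose_mul, Matrix.conjTranspose_conjTranspose,
              Matrix.mul_assoc]
        _ = 1 := by rw [hV', Matrix.mul_one, hU]
    simp [this]
  -- alpha bound
  have h1 : ∑ x, L x * ∑ y, Complex.normSq (C x y) ≤ ε := by
    rw [hC, ← trace_row U V hV']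
    exact (trace_spec_mono U L hL _ _ (test_sq (test_compl hA))).trans hα
  have h2 : ∑ y, M y * ∑ x, Complex.normSq (B x y) ≤ (spec V M * A).trace.re := by
    refine le_trans (le_of_eq ?_) (trace_spec_mono V M hM _ _ (test_sq hA))
    rw [trace_row V U hU']
    refine Finset.sum_congr rfl fun y _ => ?_
    congr 1
    refine Finset.sum_congr rfl fun x _ => ?_
    have : Vᴴ * A * U = Bᴴ := by
      rw [hB]
      simp only [Matrix.conjTranspose_mul, Matrix.conjTranspose_conjTranspose, hAh,
        Matrix.mul_assoc]
    rw [this, Matrix.conjTranspose_apply]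
    simp [Complex.normSq_apply]
  -- typical mass
  have h3 : 1 - 2 * η ≤ ∑ x ∈ X, ∑ y ∈ Y, L x * Complex.normSq (W x y) := by
    have e0 : ∑ x, ∑ y, L x * Complex.normSq (W x y) = 1 := by
      simp [← Finset.mul_sum, hrow, hL1]
    have e1 : ∑ x, ∑ y, L x * Complex.normSq (W x y)
        = ∑ x ∈ X, ∑ y, L x * Complex.normSq (W x y)
          + ∑ x ∈ Xᶜ, ∑ y, L x * Complex.normSq (W x y) :=
      (Finset.sum_add_sum_compl X _).symm
    have e2 : ∑ x ∈ Xᶜ, ∑ y, L x * Complex.normSq (W x y) ≤ η := by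
      simpa [← Finset.mul_sum, hrow] using hX
    have e3 : ∑ x ∈ X, ∑ y, L x * Complex.normSq (W x y)
        = ∑ x ∈ X, ∑ y ∈ Y, L x * Complex.normSq (W x y)
          + ∑ x ∈ X, ∑ y ∈ Yᶜ, L x * Complex.normSq (W x y) := by
      rw [← Finset.sum_add_distrib]
      exact Finset.sum_congr rfl fun x _ => (Finset.sum_add_sum_compl Y _).symm
    have e4 : ∑ x ∈ X, ∑ y ∈ Yᶜ, L x * Complex.normSq (W x y) ≤ η := by
      refine le_trans ?_ hY
      rw [Finset.sum_comm]
      refine Finset.sum_le_sum fun y _ => Finset.sum_le_univ_sum_of_nonneg fun x =>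
        mul_nonneg (hL x) (Complex.normSq_nonneg _)
    linarith
  have h4 : ∑ x ∈ X, ∑ y ∈ Y, L x * Complex.normSq (W x y) ≤
      ∑ x ∈ X, ∑ y ∈ Y, ((1 + t) * (L x * Complex.normSq (C x y)) +
        (1 + 1 / t) * (a / b * (M y * Complex.normSq (B x y)))) := by
    refine Finset.sum_le_sum fun x hx => Finset.sum_le_sum fun y hy => ?_
    rw [hCB]
    have s1 := mul_le_mul_of_nonneg_left (normSq_split t ht (C x y) (B x y)) (hL x)
    have s2 : L x ≤ a / b * M y := by
      refine (hLa x hx).trans ?_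
      rw [div_mul_eq_mul_div, le_div_iff₀ hb]
      exact mul_le_mul_of_nonneg_left (hMb y hy) ha
    have s3 := mul_le_mul_of_nonneg_right s2
      (mul_nonneg (by positivity : 0 ≤ 1 + 1 / t) (Complex.normSq_nonneg (B x y)))
    linarith
  have h5 : ∑ x ∈ X, ∑ y ∈ Y, ((1 + t) * (L x * Complex.normSq (C x y)) +
        (1 + 1 / t) * (a / b * (M y * Complex.normSq (B x y)))) ≤
      ∑ x, ∑ y, ((1 + t) * (L x * Complex.normSq (C x y)) +
        (1 + 1 / t) * (a / b * (M y * Complex.normSq (B x y)))) := by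
    have nn : ∀ x y, 0 ≤ ((1 + t) * (L x * Complex.normSq (C x y)) +
        (1 + 1 / t) * (a / b * (M y * Complex.normSq (B x y)))) := by
      intro x y
      have := hL x
      have := hM y
      have := Complex.normSq_nonneg (C x y)
      have := Complex.normSq_nonneg (B x y)
      positivity
    refine le_trans (Finset.sum_le_sum fun x _ => Finset.sum_le_univ_sum_of_nonneg (nn x)) ?_
    exact Finset.sum_le_univ_sum_of_nonneg fun x => Finset.sum_nonneg fun y _ => nn x y
  have h6 : ∑ x, ∑ y, ((1 + t) * (L x * Complex.normSq (C x y)) +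
        (1 + 1 / t) * (a / b * (M y * Complex.normSq (B x y)))) =
      (1 + t) * (∑ x, L x * ∑ y, Complex.normSq (C x y)) +
        (1 + 1 / t) * (a / b * ∑ y, M y * ∑ x, Complex.normSq (B x y)) := by
    simp only [Finset.sum_add_distrib, ← Finset.mul_sum]
    congr 3
    rw [Finset.sum_comm]
    simp only [← Finset.mul_sum]
  have h7 : (1 + t) * (∑ x, L x * ∑ y, Complex.normSq (C x y)) ≤ (1 + t) * ε := by
    gcongr
  have h8 : (1 + 1 / t) * (a / b * ∑ y, M y * ∑ x, Complex.normSq (B x y)) ≤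
      (1 + 1 / t) * (a / b * (spec V M * A).trace.re) := by
    gcongr
  linarith

end OneShot

theorem tensorPow_spec {d : ℕ} (U : Matrix (Fin d) (Fin d) ℂ) (f : Fin d → ℝ) (n : ℕ) :
    tensorPow (spec U f) n = spec (tensorPow U n) (fun x => ∏ i, f (x i)) := by
  unfold spec
  rw [tensorPow_mul, tensorPow_mul, tensorPow_star, tensorPow_diagonal]
  simp

theorem exists_spec {d : ℕ} (ρ : Matrix (Fin d) (Fin d) ℂ) (hρ : ρ.PosDef) :
    ∃ (U : Matrix (Fin d) (Fin d) ℂ) (L : Fin d → ℝ), Uᴴ * U = 1 ∧ (∀ a, 0 < L a) ∧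
      ρ = spec U L ∧ matLog ρ = spec U (fun a => Real.log (L a)) := by
  have hh : ρ.IsHermitian := hρ.1
  refine ⟨hh.eigenvectorUnitary, hh.eigenvalues, ?_, hρ.eigenvalues_pos, ?_, ?_⟩
  · have := Unitary.coe_star_mul_self hh.eigenvectorUnitary
    simpa [Matrix.star_eq_conjTranspose] using this
  · have := hh.spectral_theorem
    rw [Unitary.conjStarAlgAut_apply] at this
    exact this
  · unfold matLog matFun
    rw [dif_pos hh]
    rfl

theorem typ_bounds {d : ℕ} (L : Fin d → ℝ) (hL : ∀ a, 0 < L a) (μ δ : ℝ) (n : ℕ)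
    (x : Fin n → Fin d) (hx : x ∈ typSet (fun a => Real.log (L a)) μ δ n) :
    Real.exp (n * (μ - δ)) ≤ ∏ i, L (x i) ∧ ∏ i, L (x i) ≤ Real.exp (n * (μ + δ)) := by
  have e : ∏ i, L (x i) = Real.exp (∑ i, Real.log (L (x i))) := by
    rw [Real.exp_sum]
    exact Finset.prod_congr rfl fun i _ => (Real.exp_log (hL _)).symm
  simp only [typSet, Finset.mem_filter, Finset.mem_univ, true_and, abs_le] at hx
  rw [e, Real.exp_le_exp, Real.exp_le_exp]
  constructor <;> linarith [hx.1, hx.2]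

/-- **Quantum Stein's lemma.** For every `0 < ε < 1`,
`lim_{n→∞} (1/n) log β*_n(ε) = −D(ρ‖σ)`. -/
theorem quantum_stein_lemma {d : ℕ} (hd : 0 < d) (ρ σ : Matrix (Fin d) (Fin d) ℂ)
    (hρ : IsDensity ρ) (hσ : IsDensity σ) (hρpd : ρ.PosDef) (hσpd : σ.PosDef)
    (ε : ℝ) (hε0 : 0 < ε) (hε1 : ε < 1) :
    Tendsto (fun n : ℕ => (1 / (n : ℝ)) * Real.log (betaStar ρ σ n ε)) atTop
      (nhds (-(relEnt ρ σ))) := by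
  have hρh : ρ.IsHermitian := hρ.1.1
  have hσh : σ.IsHermitian := hσ.1.1
  obtain ⟨U, L, hU, hLpos, hρU, hLlog⟩ := exists_spec ρ hρpd
  obtain ⟨V, M, hV, hMpos, hσV, hMlog⟩ := exists_spec σ hσpd
  have hV' : V * Vᴴ = 1 := mul_eq_one_comm.mp hV
  have hL1 : ∑ a, L a = 1 := by
    rw [← trace_spec U hU, ← hρU, hρ.2]; simp
  set q : Fin d → ℝ := fun b => ∑ a, L a * Complex.normSq ((Uᴴ * V) a b) with hq
  have hq0 : ∀ b, 0 ≤ q b := fun b =>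
    Finset.sum_nonneg fun a _ => mul_nonneg (hLpos a).le (Complex.normSq_nonneg _)
  have hqf : ∀ f : Fin d → ℝ, (spec U L * spec V f).trace.re = ∑ b, q b * f b := by
    intro f
    rw [trace_spec_spec]
    simp only [hq, Finset.sum_mul, Finset.mul_sum]
    rw [Finset.sum_comm]
    refine Finset.sum_congr rfl fun b _ => Finset.sum_congr rfl fun a _ => by ring
  have hq1 : ∑ b, q b = 1 := by
    have := hqf (fun _ => 1)
    rw [spec_one V hV', Matrix.mul_one, trace_spec U hU, hL1] at this
    simpa using this.symm
  set μ1 := ∑ a, L a * Real.log (L a) with hμ1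
  set μ2 := ∑ b, q b * Real.log (M b) with hμ2
  have hD : relEnt ρ σ = μ1 - μ2 := by
    unfold relEnt
    rw [hLlog, hMlog, Matrix.mul_sub, Matrix.trace_sub, Complex.sub_re]
    rw [hρU, spec_mul U hU, trace_spec U hU, hqf]
  -- constants
  set η := min (ε / 5) ((1 - ε) / 8) with hη
  have hηpos : 0 < η := lt_min (by linarith) (by linarith)
  have hη1 : 5 * η ≤ ε := by have := min_le_left (ε / 5) ((1 - ε) / 8); linarith
  have hη2 : 8 * η ≤ 1 - ε := by have := min_le_right (ε / 5) ((1 - ε) / 8); linarith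
  set t := (1 - ε) / 2 with ht
  have htpos : 0 < t := by rw [ht]; linarith
  set c := ((1 - ε) / 4) / (1 + 1 / t) with hc
  have hcpos : 0 < c := div_pos (by linarith) (by positivity)
  have main : ∀ δ : ℝ, 0 < δ → ∀ᶠ n : ℕ in atTop,
      c * Real.exp (-(n * (μ1 - μ2 + 2 * δ))) ≤ betaStar ρ σ n ε ∧
      betaStar ρ σ n ε ≤ Real.exp (-(n * (μ1 - μ2 - 2 * δ))) := by
    intro δ hδ
    filter_upwards [wlln L (fun a => Real.log (L a)) (fun a => (hLpos a).le) hL1 δ η hδ hηpos,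
      wlln q (fun b => Real.log (M b)) hq0 hq1 δ η hδ hηpos] with n hX hY
    rw [← hμ1] at hX
    rw [← hμ2] at hY
    have eρ : tensorPow ρ n = spec (tensorPow U n) (fun x => ∏ i, L (x i)) := by
      rw [hρU, tensorPow_spec]
    have eσ : tensorPow σ n = spec (tensorPow V n) (fun x => ∏ i, M (x i)) := by
      rw [hσV, tensorPow_spec]
    have hUn : (tensorPow U n)ᴴ * tensorPow U n = 1 := by
      rw [← tensorPow_star, ← tensorPow_mul, hU, tensorPow_one]
    have hVn : (tensorPow V n)ᴴ * tensorPow V n = 1 := by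
      rw [← tensorPow_star, ← tensorPow_mul, hV, tensorPow_one]
    have hY' : ∑ y ∈ (typSet (fun b => Real.log (M b)) μ2 δ n)ᶜ, ∑ x : Fin n → Fin d,
        (∏ i, L (x i)) * Complex.normSq (((tensorPow U n)ᴴ * tensorPow V n) x y) ≤ η := by
      refine le_trans (le_of_eq ?_) hY
      refine Finset.sum_congr rfl fun y _ => ?_
      simp only [hq]
      rw [Finset.prod_univ_sum, Fintype.piFinset_univ]
      refine Finset.sum_congr rfl fun x _ => ?_
      rw [← tensorPow_star, ← tensorPow_mul, Finset.prod_mul_distrib]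
      simp [tensorPow, map_prod]
    have hLn : ∀ x : Fin n → Fin d, 0 ≤ ∏ i, L (x i) :=
      fun x => Finset.prod_nonneg fun i _ => (hLpos _).le
    have hMn : ∀ x : Fin n → Fin d, 0 ≤ ∏ i, M (x i) :=
      fun x => Finset.prod_nonneg fun i _ => (hMpos _).le
    have hLn1 : ∑ x : Fin n → Fin d, ∏ i, L (x i) = 1 :=
      (wlln_moments L (fun _ => 0) hL1 (by simp) n).1
    have bX := fun x hx => typ_bounds L hLpos μ1 δ n x hx
    have bY := fun x hx => typ_bounds M hMpos μ2 δ n x hx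
    obtain ⟨A, hA, hAα, hAβ⟩ := oneShot_direct (tensorPow U n) (tensorPow V n) hUn hVn
      (fun x => ∏ i, L (x i)) (fun x => ∏ i, M (x i)) hLn hLn1 _ _ η
      (Real.exp (n * (μ1 - δ))) (Real.exp (n * (μ2 + δ))) (Real.exp_pos _) (Real.exp_pos _).le
      hX hY' (fun x hx => (bX x hx).1) (fun y hy => (bY y hy).2)
    rw [← eρ] at hAα
    rw [← eσ] at hAβ
    have hlow : ∀ b ∈ {b : ℝ | ∃ A : Matrix (Fin n → Fin d) (Fin n → Fin d) ℂ,
        IsTest A ∧ alphaErr ρ n A ≤ ε ∧ b = betaErr σ n A},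
        c * Real.exp (-(n * (μ1 - μ2 + 2 * δ))) ≤ b := by
      rintro b ⟨A, hA, hα, rfl⟩
      unfold alphaErr at hα
      rw [eρ] at hα
      have h := oneShot_converse (tensorPow U n) (tensorPow V n) hUn hVn
        (fun x => ∏ i, L (x i)) (fun x => ∏ i, M (x i)) hLn hMn hLn1 _ _ η
        (Real.exp (n * (μ1 + δ))) (Real.exp (n * (μ2 - δ))) ε t (Real.exp_pos _).le
        (Real.exp_pos _) htpos hX hY' (fun x hx => (bX x hx).2) (fun y hy => (bY y hy).1) A hA hα
      rw [← eσ, ← Real.exp_sub] at h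
      change _ ≤ _ + _ * (_ * betaErr σ n A) at h
      have h1 : (1 - ε) / 4 ≤ (1 + 1 / t) *
          (Real.exp (n * (μ1 + δ) - n * (μ2 - δ)) * betaErr σ n A) := by
        have : (1 + t) * ε ≤ ε + (1 - ε) / 2 := by rw [ht]; nlinarith
        linarith
      have h2 : c ≤ Real.exp (n * (μ1 + δ) - n * (μ2 - δ)) * betaErr σ n A := by
        rw [hc, div_le_iff₀ (by positivity)]
        linarith
      have h3 := mul_le_mul_of_nonneg_right h2
        (Real.exp_pos (-(n * (μ1 - μ2 + 2 * δ)))).le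
      refine h3.trans (le_of_eq ?_)
      rw [mul_right_comm, ← Real.exp_add]
      have : (n * (μ1 + δ) - n * (μ2 - δ) + -(n * (μ1 - μ2 + 2 * δ)) : ℝ) = 0 := by ring
      rw [this, Real.exp_zero, one_mul]
    have hmem : betaErr σ n A ∈ {b : ℝ | ∃ A : Matrix (Fin n → Fin d) (Fin n → Fin d) ℂ,
        IsTest A ∧ alphaErr ρ n A ≤ ε ∧ b = betaErr σ n A} :=
      ⟨A, hA, hAα.trans hη1, rfl⟩
    refine ⟨le_csInf ⟨_, hmem⟩ hlow, (csInf_le ⟨_, hlow⟩ hmem).trans (hAβ.trans (le_of_eq ?_))⟩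
    rw [← Real.exp_sub]
    congr 1
    ring
  rw [hD, Metric.tendsto_nhds]
  intro δ hδ
  obtain ⟨N, hN⟩ := exists_nat_gt (|Real.log c| / (δ / 4))
  filter_upwards [main (δ / 4) (by linarith), eventually_ge_atTop (N + 1)] with n hn hnN
  obtain ⟨hlo, hhi⟩ := hn
  have hnpos : (0:ℝ) < n := by
    have : 0 < n := by omega
    exact_mod_cast this
  have hNn : (N : ℝ) ≤ n := by exact_mod_cast (by omega : N ≤ n)
  have hlopos : 0 < c * Real.exp (-(n * (μ1 - μ2 + 2 * (δ / 4)))) :=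
    mul_pos hcpos (Real.exp_pos _)
  have l1 := Real.log_le_log hlopos hlo
  have l2 := Real.log_le_log (hlopos.trans_le hlo) hhi
  rw [Real.log_mul hcpos.ne' (Real.exp_pos _).ne', Real.log_exp] at l1
  rw [Real.log_exp] at l2
  have hcn : |Real.log c| < n * (δ / 4) := by
    rw [div_lt_iff₀ (by linarith)] at hN
    refine hN.trans_le ?_
    gcongr
  have hcn' := neg_abs_le (Real.log c)
  rw [Real.dist_eq, abs_lt, one_div, inv_mul_eq_div]
  constructor
  · rw [lt_sub_iff_add_lt, lt_div_iff₀ hnpos]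
    nlinarith
  · rw [sub_lt_iff_lt_add, div_lt_iff₀ hnpos]
    nlinarith

end
end

section
/- (Hiai–Petz theorem.) D(ρ‖σ) = lim_{n→∞} (1/n) sup_{M_n} D_{M_n}(ρ_n‖σ_n), where the supremum is over all POVMs M_n on the d^n-dimensional space. -/
open Matrix Filter
open scoped ComplexOrder

noncomputable section

/-- A POVM: a finite family of positive semidefinite matrices summing to the identity. -/
def IsPOVM {m : Type*} [Fintype m] [DecidableEq m] {k : ℕ}
    (M : Fin k → Matrix m m ℂ) : Prop :=
  (∀ i, (M i).PosSemidef) ∧ ∑ i, M i = 1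

/-- The classical relative entropy `D_M(ρ‖σ)` between the outcome distributions of the
POVM `M` under the states `ρ` and `σ`. -/
def measuredRelEnt {m : Type*} [Fintype m] [DecidableEq m] (ρ σ : Matrix m m ℂ)
    {k : ℕ} (M : Fin k → Matrix m m ℂ) : ℝ :=
  ∑ i, ((ρ * M i).trace).re *
    Real.log (((ρ * M i).trace).re / ((σ * M i).trace).re)

namespace HP2
variable {m : Type*} [Fintype m] [DecidableEq m]

lemma block_entry {L : Type*} [Fintype L] [DecidableEq L] {B : L → Type*} [∀ l, Fintype (B l)]
    [∀ l, DecidableEq (B l)] (V : ∀ l, Matrix (B l) (B l) ℂ) (H : Matrix (Sigma B) (Sigma B) ℂ)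
    (l : L) (i j : B l) :
    ((Matrix.blockDiagonal' V)ᴴ * H * Matrix.blockDiagonal' V) ⟨l, i⟩ ⟨l, j⟩
      = ((V l)ᴴ * (H.submatrix (Sigma.mk l) (Sigma.mk l)) * V l) i j := by
  have hR : ∀ (X : Matrix (Sigma B) (Sigma B) ℂ) (p : Sigma B),
      (X * Matrix.blockDiagonal' V) p ⟨l, j⟩ = ∑ x, X p ⟨l, x⟩ * V l x j := by
    intro X p
    rw [Matrix.mul_apply, Fintype.sum_sigma, Finset.sum_eq_single l]
    · simp [Matrix.blockDiagonal'_apply_eq]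
    · intro l' _ hne
      refine Finset.sum_eq_zero fun x _ => ?_
      rw [Matrix.blockDiagonal'_apply_ne _ _ _ hne, mul_zero]
    · simp
  have hL : ∀ (p : Sigma B),
      ((Matrix.blockDiagonal' V)ᴴ * H) ⟨l, i⟩ p = ∑ x, star (V l x i) * H ⟨l, x⟩ p := by
    intro p
    rw [Matrix.mul_apply, Fintype.sum_sigma, Finset.sum_eq_single l]
    · simp [Matrix.conjTranspose_apply, Matrix.blockDiagonal'_apply_eq]
    · intro l' _ hne
      refine Finset.sum_eq_zero fun x _ => ?_
      rw [Matrix.conjTranspose_apply, Matrix.blockDiagonal'_apply_ne _ _ _ hne, star_zero, zero_mul]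
    · simp
  rw [hR]
  simp only [hL, Matrix.mul_apply, Matrix.conjTranspose_apply, Matrix.submatrix_apply]

lemma diag_exists {n : Type*} [Fintype n] [DecidableEq n] (H : Matrix n n ℂ)
    (hH : H.IsHermitian) : ∃ V : Matrix n n ℂ, Vᴴ * V = 1 ∧
      ∀ i j, i ≠ j → (Vᴴ * H * V) i j = 0 := by
  refine ⟨hH.eigenvectorUnitary, ?_, ?_⟩
  · exact Unitary.coe_star_mul_self hH.eigenvectorUnitary
  · intro i j hij
    have h := hH.spectral_theorem
    rw [Unitary.conjStarAlgAut_apply] at h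
    have h1 := Unitary.coe_star_mul_self hH.eigenvectorUnitary
    have h2 : (hH.eigenvectorUnitary : Matrix n n ℂ)ᴴ * H * (hH.eigenvectorUnitary : Matrix n n ℂ)
        = Matrix.diagonal (RCLike.ofReal ∘ hH.eigenvalues) := by
      set E := (hH.eigenvectorUnitary : Matrix n n ℂ)
      change Eᴴ * E = 1 at h1
      change H = E * _ * Eᴴ at h
      calc _ = Eᴴ * (E * Matrix.diagonal (RCLike.ofReal ∘ hH.eigenvalues) * Eᴴ) * E := by
              rw [← h]
        _ = (Eᴴ * E) * Matrix.diagonal (RCLike.ofReal ∘ hH.eigenvalues) * (Eᴴ * E) := by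
          simp only [Matrix.mul_assoc]
        _ = _ := by rw [h1]; simp
    rw [h2, Matrix.diagonal_apply_ne _ hij]

lemma block_diag_exists {L : Type*} [Fintype L] [DecidableEq L] (ℓ : m → L)
    (H : Matrix m m ℂ) (hH : H.IsHermitian) :
    ∃ W : Matrix m m ℂ, Wᴴ * W = 1 ∧ (∀ x y, ℓ x ≠ ℓ y → W x y = 0) ∧
      ∀ x y, x ≠ y → ℓ x = ℓ y → (Wᴴ * H * W) x y = 0 := by
  have hV : ∀ l : L, ∃ V : Matrix {x // ℓ x = l} {x // ℓ x = l} ℂ, Vᴴ * V = 1 ∧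
      ∀ i j, i ≠ j → (Vᴴ * (H.submatrix Subtype.val Subtype.val : Matrix {x // ℓ x = l} {x // ℓ x = l} ℂ) * V : Matrix {x // ℓ x = l} {x // ℓ x = l} ℂ) i j = 0 :=
    fun l => diag_exists _ (hH.submatrix _)
  choose V hV1 hV2 using hV
  set e := Equiv.sigmaFiberEquiv ℓ with he
  set W0 := Matrix.blockDiagonal' V with hW0
  have h1 : W0ᴴ * W0 = 1 := by
    rw [hW0, Matrix.blockDiagonal'_conjTranspose, ← Matrix.blockDiagonal'_mul]
    simp only [hV1]
    exact Matrix.blockDiagonal'_one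
  have hes : ∀ x, e.symm x = ⟨ℓ x, x, rfl⟩ := fun x => by
    rw [Equiv.symm_apply_eq]; rfl
  refine ⟨W0.submatrix e.symm e.symm, ?_, ?_, ?_⟩
  · rw [Matrix.conjTranspose_submatrix, Matrix.submatrix_mul_equiv, h1, Matrix.submatrix_one_equiv]
  · intro x y hxy
    rw [Matrix.submatrix_apply, hes, hes, hW0, Matrix.blockDiagonal'_apply_ne _ _ _ hxy]
  · intro x y hne hxy
    have hHs : H = (H.submatrix e e).submatrix e.symm e.symm := by
      ext; simp
    rw [hHs, Matrix.conjTranspose_submatrix, Matrix.submatrix_mul_equiv,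
      Matrix.submatrix_mul_equiv, Matrix.submatrix_apply, hes, hes]
    have hy : (⟨ℓ y, ⟨y, rfl⟩⟩ : Σ l, {x // ℓ x = l}) = ⟨ℓ x, ⟨y, hxy.symm⟩⟩ := by
      rw [Sigma.mk.injEq]
      refine ⟨hxy.symm, ?_⟩
      rw [Subtype.heq_iff_coe_eq]
      intro z; rw [hxy]
    rw [hy, hW0, block_entry]
    refine hV2 (ℓ x) _ _ ?_
    intro h
    exact hne (congrArg Subtype.val h)

end HP2

namespace HP

variable {m : Type*} [Fintype m] [DecidableEq m]

/-- The diagonal matrix with given real entries, conjugated by `U`. -/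
def conjDiag (U : Matrix m m ℂ) (r : m → ℝ) : Matrix m m ℂ :=
  U * Matrix.diagonal (fun i => (r i : ℂ)) * Uᴴ

/-- Nussbaum–Szkola expression for the relative entropy. -/
def NS (U : Matrix m m ℂ) (r : m → ℝ) (V : Matrix m m ℂ) (s : m → ℝ) : ℝ :=
  ∑ a, ∑ b, r a * ‖(Uᴴ * V) a b‖ ^ 2 * (Real.log (r a) - Real.log (s b))

lemma tr_conjDiag (U : Matrix m m ℂ) (r : m → ℝ) (X : Matrix m m ℂ) :
    ((conjDiag U r * X).trace).re = ∑ a, r a * ((Uᴴ * X * U) a a).re := by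
  have h : (conjDiag U r * X).trace
      = (Matrix.diagonal (fun i => (r i : ℂ)) * (Uᴴ * X * U)).trace := by
    unfold conjDiag
    rw [Matrix.mul_assoc, Matrix.mul_assoc, Matrix.trace_mul_comm]
    simp only [Matrix.mul_assoc]
  rw [h, Matrix.trace, Complex.re_sum]
  refine Finset.sum_congr rfl fun a _ => ?_
  rw [Matrix.diag_apply, Matrix.diagonal_mul, Complex.re_ofReal_mul]

lemma mul_conjT_diag {n : Type*} [Fintype n] (G : Matrix m n ℂ) (a : m) :
    ((G * Gᴴ) a a).re = ∑ b, ‖G a b‖ ^ 2 := by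
  rw [Matrix.mul_apply, Complex.re_sum]
  refine Finset.sum_congr rfl fun b _ => ?_
  rw [Matrix.conjTranspose_apply, Complex.star_def, Complex.mul_conj, Complex.ofReal_re,
    Complex.normSq_eq_norm_sq]

lemma conjT_mul_diag {n : Type*} [Fintype n] (G : Matrix n m ℂ) (a : m) :
    ((Gᴴ * G) a a).re = ∑ b, ‖G b a‖ ^ 2 := by
  have := mul_conjT_diag Gᴴ a
  rw [Matrix.conjTranspose_conjTranspose] at this
  rw [this]
  simp [Matrix.conjTranspose_apply]

lemma tr_nonneg (U : Matrix m m ℂ) (r : m → ℝ) (hr : ∀ a, 0 ≤ r a) (X : Matrix m m ℂ)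
    (hX : X.PosSemidef) : 0 ≤ ((conjDiag U r * X).trace).re := by
  rw [tr_conjDiag]
  refine Finset.sum_nonneg fun a _ => mul_nonneg (hr a) ?_
  have h := (hX.conjTranspose_mul_mul_same U).diag_nonneg (i := a)
  exact (Complex.le_def.1 h).1

lemma tr_eq_zero (U : Matrix m m ℂ) (hU : U * Uᴴ = 1) (r : m → ℝ) (hr : ∀ a, 0 < r a)
    (X : Matrix m m ℂ)
    (hX : X.PosSemidef) (h0 : ((conjDiag U r * X).trace).re = 0) : X = 0 := by
  rw [tr_conjDiag] at h0
  have hps := hX.conjTranspose_mul_mul_same U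
  have hd : ∀ a, 0 ≤ ((Uᴴ * X * U) a a).re := fun a =>
    (Complex.le_def.1 (hps.diag_nonneg (i := a))).1
  have h1 := (Finset.sum_eq_zero_iff_of_nonneg
    (fun a _ => mul_nonneg (hr a).le (hd a))).1 h0
  have h2 : (Uᴴ * X * U).trace = 0 := by
    rw [Matrix.trace]
    refine Finset.sum_eq_zero fun a ha => ?_
    have h3 := h1 a ha
    have h4 : ((Uᴴ * X * U) a a).re = 0 := by
      rcases mul_eq_zero.1 h3 with h | h
      · exact absurd h (hr a).ne'
      · exact h
    have h5 := (Complex.le_def.1 (hps.diag_nonneg (i := a))).2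
    refine Complex.ext h4 ?_
    simpa using h5.symm
  have h6 := hps.trace_eq_zero_iff.1 h2
  calc X = (U * Uᴴ) * X * (U * Uᴴ) := by rw [hU]; simp
    _ = U * (Uᴴ * X * U) * Uᴴ := by simp only [Matrix.mul_assoc]
    _ = 0 := by rw [h6]; simp

lemma var_bound (U V : Matrix m m ℂ) (hU : U * Uᴴ = 1) (hV : V * Vᴴ = 1)
    (r s : m → ℝ) (hr : ∀ a, 0 < r a) (hs : ∀ a, 0 < s a) (A : Matrix m m ℂ)
    (hA : Aᴴ = A) (t : ℝ) (ht : 0 < t) :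
    2 * ((conjDiag U r * A).trace).re - ((conjDiag V s * (A * A)).trace).re
      - t * ((conjDiag U r * (A * A)).trace).re
    ≤ ∑ a, ∑ b, r a * ‖(Uᴴ * V) a b‖ ^ 2 / (s b / r a + t) := by
  set G := Uᴴ * A * V with hG
  set u := Uᴴ * V with hu
  have hGt : Gᴴ = Vᴴ * A * U := by
    rw [hG]; simp [Matrix.conjTranspose_mul, hA, Matrix.mul_assoc]
  have e1 : Uᴴ * A * U = G * uᴴ := by
    calc Uᴴ * A * U = Uᴴ * A * (V * Vᴴ) * U := by rw [hV]; simp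
      _ = G * uᴴ := by simp [hG, hu, Matrix.conjTranspose_mul, Matrix.mul_assoc]
  have e2 : Uᴴ * (A * A) * U = G * Gᴴ := by
    calc Uᴴ * (A * A) * U = Uᴴ * A * (V * Vᴴ) * A * U := by rw [hV]; simp [Matrix.mul_assoc]
      _ = G * Gᴴ := by rw [hGt]; simp [hG, Matrix.mul_assoc]
  have e3 : Vᴴ * (A * A) * V = Gᴴ * G := by
    calc Vᴴ * (A * A) * V = Vᴴ * A * (U * Uᴴ) * A * V := by rw [hU]; simp [Matrix.mul_assoc]
      _ = Gᴴ * G := by rw [hGt]; simp [hG, Matrix.mul_assoc]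
  rw [tr_conjDiag, tr_conjDiag, tr_conjDiag, e1, e2, e3]
  have f1 : ∀ a, ((G * uᴴ) a a).re = ∑ b, (G a b * star (u a b)).re := by
    intro a
    rw [Matrix.mul_apply, Complex.re_sum]; rfl
  simp only [mul_conjT_diag, conjT_mul_diag, f1, Finset.mul_sum]
  rw [Finset.sum_comm (f := fun i i_1 => s i * ‖G i_1 i‖ ^ 2)]
  simp only [← Finset.sum_sub_distrib]
  refine Finset.sum_le_sum fun a _ => Finset.sum_le_sum fun b _ => ?_
  have hra := hr a
  have hsb := hs b
  have hre : (G a b * star (u a b)).re ≤ ‖G a b‖ * ‖u a b‖ := by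
    refine (Complex.re_le_norm _).trans ?_
    rw [norm_mul, norm_star]
  set x := ‖G a b‖
  set y := ‖u a b‖
  have hden : 0 < s b / r a + t := by positivity
  rw [le_div_iff₀ hden]
  have hk : r a * (s b / r a + t) = s b + t * r a := by field_simp
  have h1 : 2 * (r a * (G a b * star (u a b)).re) ≤ 2 * (r a * (x * y)) := by gcongr
  have h2 : 2 * (r a * (G a b * star (u a b)).re) - s b * x ^ 2 - t * (r a * x ^ 2)
      ≤ r a * (2 * x * y - (s b / r a + t) * x ^ 2) := by
    have : r a * (2 * x * y - (s b / r a + t) * x ^ 2)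
      = 2 * (r a * (x * y)) - (r a * (s b / r a + t)) * x ^ 2 := by ring
    rw [this, hk]; nlinarith
  calc _ ≤ r a * (2 * x * y - (s b / r a + t) * x ^ 2) * (s b / r a + t) := by gcongr
    _ = r a * ((2 * ((s b / r a + t) * x) * y - ((s b / r a + t) * x) ^ 2)) := by ring
    _ ≤ r a * y ^ 2 := by
      gcongr
      nlinarith [sq_nonneg ((s b / r a + t) * x - y)]

lemma kadison (U : Matrix m m ℂ) (r : m → ℝ) (hr : ∀ a, 0 ≤ r a) {k : ℕ}
    (M : Fin k → Matrix m m ℂ) (hM : IsPOVM M) (c : Fin k → ℝ) :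
    ((conjDiag U r * ((∑ i, (c i : ℂ) • M i) * (∑ i, (c i : ℂ) • M i))).trace).re
      ≤ ∑ i, c i ^ 2 * ((conjDiag U r * M i).trace).re := by
  set A := ∑ i, (c i : ℂ) • M i with hA
  have hAh : Aᴴ = A := by
    rw [hA, Matrix.conjTranspose_sum]
    refine Finset.sum_congr rfl fun i _ => ?_
    rw [Matrix.conjTranspose_smul, (hM.1 i).1.eq]; simp
  have key : ∑ i, ((c i : ℂ) • (1 : Matrix m m ℂ) - A) * M i * ((c i : ℂ) • 1 - A)
      = ∑ i, ((c i : ℂ) ^ 2) • M i - A * A := by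
    have h : ∀ i, ((c i : ℂ) • (1 : Matrix m m ℂ) - A) * M i * ((c i : ℂ) • 1 - A)
      = ((c i : ℂ) ^ 2) • M i - ((c i : ℂ) • M i) * A - A * ((c i : ℂ) • M i) + A * M i * A := by
      intro i
      simp only [sub_mul, mul_sub, Matrix.smul_mul, Matrix.mul_smul, one_mul, mul_one, smul_smul,
        sq, Matrix.mul_assoc]
      abel
    simp only [h, Finset.sum_add_distrib, Finset.sum_sub_distrib]
    rw [← Finset.sum_mul, ← Finset.mul_sum, ← Finset.sum_mul, ← Finset.mul_sum, hM.2, ← hA]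
    simp
  have hps : (∑ i, ((c i : ℂ) ^ 2) • M i - A * A).PosSemidef := by
    rw [← key]
    refine Matrix.posSemidef_sum _ fun i _ => ?_
    have h1 := (hM.1 i).conjTranspose_mul_mul_same ((c i : ℂ) • (1 : Matrix m m ℂ) - A)
    have h2 : ((c i : ℂ) • (1 : Matrix m m ℂ) - A)ᴴ = (c i : ℂ) • (1 : Matrix m m ℂ) - A := by
      rw [Matrix.conjTranspose_sub, Matrix.conjTranspose_smul, hAh]; simp
    rwa [h2] at h1
  have h := tr_nonneg U r hr _ hps
  rw [Matrix.mul_sub, Matrix.trace_sub, Complex.sub_re] at h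
  have e : ((conjDiag U r * ∑ i, ((c i : ℂ) ^ 2) • M i).trace).re
      = ∑ i, c i ^ 2 * ((conjDiag U r * M i).trace).re := by
    rw [Matrix.mul_sum, Matrix.trace_sum, Complex.re_sum]
    refine Finset.sum_congr rfl fun i _ => ?_
    rw [Matrix.mul_smul, Matrix.trace_smul, smul_eq_mul, ← Complex.ofReal_pow,
      Complex.re_ofReal_mul]
  linarith

lemma log_sum_le {ι κ : Type*} [Fintype ι] [Fintype κ] (P x : ι → ℝ) (p y : κ → ℝ)
    (hx : ∀ j, 0 < x j) (hy : ∀ i, 0 < y i) (hP : ∑ j, P j = 1) (hp : ∑ i, p i = 1)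
    (h : ∀ t, 0 < t → ∑ i, p i / (y i + t) ≤ ∑ j, P j / (x j + t)) :
    ∑ j, P j * Real.log (x j) ≤ ∑ i, p i * Real.log (y i) := by
  set F : ℝ → ℝ := fun t => ∑ j, P j * Real.log (x j + t) - ∑ i, p i * Real.log (y i + t) with hF
  have hder : ∀ t, 0 ≤ t → HasDerivAt F (∑ j, P j / (x j + t) - ∑ i, p i / (y i + t)) t := by
    intro t ht
    have g : ∀ a c : ℝ, 0 < a → HasDerivAt (fun t => c * Real.log (a + t)) (c / (a + t)) t := by
      intro a c ha
      have h1 := ((hasDerivAt_id t).const_add a).log (by simp; positivity)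
      simpa [div_eq_mul_inv] using h1.const_mul c
    exact (HasDerivAt.fun_sum fun j _ => g _ _ (hx j)).sub (HasDerivAt.fun_sum fun i _ => g _ _ (hy i))
  have hmono : MonotoneOn F (Set.Ici 0) := by
    refine monotoneOn_of_deriv_nonneg (convex_Ici 0)
      (fun t ht => (hder t ht).continuousAt.continuousWithinAt) ?_ ?_
    · intro t ht
      rw [interior_Ici] at ht
      exact (hder t (le_of_lt ht)).differentiableAt.differentiableWithinAt
    · intro t ht
      rw [interior_Ici] at ht
      rw [(hder t (le_of_lt ht)).deriv]
      have := h t ht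
      linarith
  have hlim : Tendsto F atTop (nhds 0) := by
    have g : ∀ a : ℝ, 0 < a → Tendsto (fun t => Real.log (a + t) - Real.log t) atTop (nhds 0) := by
      intro a ha
      have h1 : Tendsto (fun t : ℝ => a / t + 1) atTop (nhds (0 + 1)) :=
        (tendsto_const_nhds.div_atTop tendsto_id).add tendsto_const_nhds
      have h2 := h1.log (by norm_num)
      simp only [zero_add, Real.log_one] at h2
      refine h2.congr' ?_
      filter_upwards [eventually_gt_atTop 0] with t ht
      rw [← Real.log_div (by positivity) (by positivity)]
      congr 1
      field_simp
    have h2 : Tendsto (fun t => ∑ j, P j * (Real.log (x j + t) - Real.log t)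
        - ∑ i, p i * (Real.log (y i + t) - Real.log t)) atTop
        (nhds (∑ j, P j * 0 - ∑ i, p i * 0)) :=
      (tendsto_finsetSum _ fun j _ => (g _ (hx j)).const_mul _).sub
        (tendsto_finsetSum _ fun i _ => (g _ (hy i)).const_mul _)
    simp only [mul_zero, Finset.sum_const_zero, sub_zero] at h2
    refine h2.congr fun t => ?_
    simp only [mul_sub, Finset.sum_sub_distrib, ← Finset.sum_mul, hP, hp, hF]
    ring
  have h0 : F 0 ≤ 0 := by
    refine ge_of_tendsto hlim ?_
    filter_upwards [eventually_ge_atTop 0] with t ht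
    exact hmono (Set.mem_Ici.2 le_rfl) ht ht
  simp only [hF, add_zero] at h0
  linarith

lemma conjDiag_trace (U : Matrix m m ℂ) (hU : Uᴴ * U = 1) (r : m → ℝ) :
    ((conjDiag U r).trace).re = ∑ a, r a := by
  have := tr_conjDiag U r 1
  simpa [hU] using this

lemma sum_row (U V : Matrix m m ℂ) (hU : Uᴴ * U = 1) (hV : V * Vᴴ = 1) (a : m) :
    ∑ b, ‖(Uᴴ * V) a b‖ ^ 2 = 1 := by
  rw [← mul_conjT_diag]
  have : Uᴴ * V * (Uᴴ * V)ᴴ = 1 := by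
    calc _ = Uᴴ * (V * Vᴴ) * U := by simp [Matrix.conjTranspose_mul, Matrix.mul_assoc]
      _ = 1 := by rw [hV]; simp [hU]
  rw [this]; simp

theorem upper (U V : Matrix m m ℂ) (hU : U * Uᴴ = 1) (hV : V * Vᴴ = 1)
    (r s : m → ℝ) (hr : ∀ a, 0 < r a) (hs : ∀ a, 0 < s a) (hr1 : ∑ a, r a = 1) {k : ℕ}
    (M : Fin k → Matrix m m ℂ) (hM : IsPOVM M) :
    measuredRelEnt (conjDiag U r) (conjDiag V s) M ≤ NS U r V s := by
  have hU' : Uᴴ * U = 1 := mul_eq_one_comm.1 hU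
  set p : Fin k → ℝ := fun i => ((conjDiag U r * M i).trace).re with hp
  set q : Fin k → ℝ := fun i => ((conjDiag V s * M i).trace).re with hq
  have hp0 : ∀ i, 0 ≤ p i := fun i => tr_nonneg U r (fun a => (hr a).le) _ (hM.1 i)
  have hq0 : ∀ i, 0 ≤ q i := fun i => tr_nonneg V s (fun a => (hs a).le) _ (hM.1 i)
  have hpq : ∀ i, p i = 0 → q i = 0 := by
    intro i hi
    have := tr_eq_zero U hU r hr _ (hM.1 i) hi
    simp [hq, this]
  have hqp : ∀ i, q i = 0 → p i = 0 := by
    intro i hi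
    have := tr_eq_zero V hV s hs _ (hM.1 i) hi
    simp [hp, this]
  set y : Fin k → ℝ := fun i => if p i = 0 then 1 else q i / p i with hy
  have hy0 : ∀ i, 0 < y i := by
    intro i
    simp only [hy]
    split_ifs with h
    · exact one_pos
    · exact div_pos ((hq0 i).lt_of_ne fun h' => h (hqp i h'.symm)) ((hp0 i).lt_of_ne (Ne.symm h))
  have hyq : ∀ i, y i * p i = q i := by
    intro i
    simp only [hy]
    split_ifs with h
    · rw [h, hpq i h]; simp
    · field_simp
  have hpsum : ∑ i, p i = 1 := by
    rw [← hr1, ← conjDiag_trace U hU' r]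
    simp only [hp]
    rw [← Complex.re_sum, ← Matrix.trace_sum, ← Matrix.mul_sum, hM.2, mul_one]
  have hmain := log_sum_le (fun ab : m × m => r ab.1 * ‖(Uᴴ * V) ab.1 ab.2‖ ^ 2)
    (fun ab => s ab.2 / r ab.1) p y (fun ab => div_pos (hs _) (hr _)) hy0 ?_ hpsum ?_
  · rw [Fintype.sum_prod_type] at hmain
    have e1 : measuredRelEnt (conjDiag U r) (conjDiag V s) M = - ∑ i, p i * Real.log (y i) := by
      unfold measuredRelEnt
      rw [← Finset.sum_neg_distrib]
      refine Finset.sum_congr rfl fun i _ => ?_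
      change p i * Real.log (p i / q i) = _
      by_cases h : p i = 0
      · simp [h]
      · simp only [hy, h, if_false]
        rw [← inv_div (q i) (p i), Real.log_inv]; ring
    have e2 : NS U r V s = - ∑ a, ∑ b, r a * ‖(Uᴴ * V) a b‖ ^ 2 * Real.log (s b / r a) := by
      unfold NS
      rw [← Finset.sum_neg_distrib]
      refine Finset.sum_congr rfl fun a _ => ?_
      rw [← Finset.sum_neg_distrib]
      refine Finset.sum_congr rfl fun b _ => ?_
      rw [Real.log_div (hs b).ne' (hr a).ne']; ring
    rw [e1, e2]
    linarith
  · rw [Fintype.sum_prod_type]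
    simp only [← Finset.mul_sum, sum_row U V hU' hV, mul_one, hr1]
  · intro t ht
    rw [Fintype.sum_prod_type]
    set c : Fin k → ℝ := fun i => 1 / (y i + t) with hc
    set A := ∑ i, (c i : ℂ) • M i with hA
    have hAh : Aᴴ = A := by
      rw [hA, Matrix.conjTranspose_sum]
      refine Finset.sum_congr rfl fun i _ => ?_
      rw [Matrix.conjTranspose_smul, (hM.1 i).1.eq]; simp
    refine le_trans ?_ (var_bound U V hU hV r s hr hs A hAh t ht)
    have k1 := kadison U r (fun a => (hr a).le) M hM c
    have k2 := kadison V s (fun a => (hs a).le) M hM c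
    rw [← hA] at k1 k2
    have k3 : ((conjDiag U r * A).trace).re = ∑ i, c i * p i := by
      rw [hA, Matrix.mul_sum, Matrix.trace_sum, Complex.re_sum]
      refine Finset.sum_congr rfl fun i _ => ?_
      rw [Matrix.mul_smul, Matrix.trace_smul, smul_eq_mul, Complex.re_ofReal_mul]
    have k4 : ∑ i, p i / (y i + t) = 2 * ∑ i, c i * p i - ∑ i, c i ^ 2 * q i
        - t * ∑ i, c i ^ 2 * p i := by
      simp only [Finset.mul_sum, ← Finset.sum_sub_distrib]
      refine Finset.sum_congr rfl fun i _ => ?_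
      have := hy0 i
      rw [← hyq i]
      simp only [hc]
      field_simp
      ring
    rw [k4, k3]
    have k5 := mul_le_mul_of_nonneg_left k1 ht.le
    linarith

lemma block_comm {L : Type*} (ℓ : m → L) (W : Matrix m m ℂ)
    (hW : ∀ x y, ℓ x ≠ ℓ y → W x y = 0) (g : m → ℝ) (hg : ∀ x y, ℓ x = ℓ y → g x = g y) :
    W * Matrix.diagonal (fun i => (g i : ℂ)) = Matrix.diagonal (fun i => (g i : ℂ)) * W := by
  ext x y
  rw [Matrix.mul_diagonal, Matrix.diagonal_mul]
  by_cases h : ℓ x = ℓ y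
  · rw [hg x y h, mul_comm]
  · rw [hW x y h]; simp

lemma conjDiag_diag (T : Matrix m m ℂ) (r : m → ℝ) (j k : m) :
    (Tᴴ * Matrix.diagonal (fun i => (r i : ℂ)) * T) j k
      = ∑ a, (r a : ℂ) * (star (T a j) * T a k) := by
  rw [Matrix.mul_apply]
  refine Finset.sum_congr rfl fun a _ => ?_
  rw [Matrix.mul_diagonal, Matrix.conjTranspose_apply]; ring

/-- Inside one block, the rescaled weights sum to at most one. -/
lemma block_weight {L : Type*} [DecidableEq L] (ℓ : m → L) (T : Matrix m m ℂ) (r : m → ℝ)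
    (hr : ∀ a, 0 < r a) (p : m → ℝ) (hp0 : ∀ j, 0 < p j)
    (hp : ∀ j, ∑ a, r a * ‖T a j‖ ^ 2 = p j)
    (hoff : ∀ j k, j ≠ k → ℓ j = ℓ k → ∑ a, (r a : ℂ) * (star (T a j) * T a k) = 0)
    (a : m) (l : L) :
    ∑ j with ℓ j = l, r a * ‖T a j‖ ^ 2 / p j ≤ 1 := by
  set S := Finset.univ.filter (fun j => ℓ j = l) with hS
  set g : ℝ := ∑ j ∈ S, ‖T a j‖ ^ 2 / p j with hg
  have hg0 : 0 ≤ g := Finset.sum_nonneg fun j _ => by have := hp0 j; positivity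
  set x : m → ℂ := fun j => star (T a j) / (p j : ℂ) with hx
  have hT : ∑ j ∈ S, T a j * x j = (g : ℂ) := by
    rw [hg]; push_cast
    refine Finset.sum_congr rfl fun j _ => ?_
    rw [hx]
    simp only
    rw [← mul_div_assoc, Complex.star_def, Complex.mul_conj, Complex.normSq_eq_norm_sq]
    push_cast; rfl
  have hdiag : ∀ j, ∑ b, (r b : ℂ) * (star (T b j) * T b j) = (p j : ℂ) := by
    intro j
    rw [← hp j]; push_cast
    refine Finset.sum_congr rfl fun b _ => ?_
    rw [mul_comm (star _), Complex.star_def, Complex.mul_conj, Complex.normSq_eq_norm_sq]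
    push_cast; rfl
  have hquad : ∑ b, r b * ‖∑ j ∈ S, T b j * x j‖ ^ 2 = g := by
    have hc : ((∑ b, r b * ‖∑ j ∈ S, T b j * x j‖ ^ 2 : ℝ) : ℂ) = (g : ℂ) := by
      push_cast
      have e1 : ∀ b, (r b : ℂ) * (‖∑ j ∈ S, T b j * x j‖ : ℂ) ^ 2
          = ∑ j ∈ S, ∑ k ∈ S, (star (x j) * x k) * ((r b : ℂ) * (star (T b j) * T b k)) := by
        intro b
        have : ((‖∑ j ∈ S, T b j * x j‖ : ℂ)) ^ 2
            = star (∑ j ∈ S, T b j * x j) * (∑ j ∈ S, T b j * x j) := by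
          rw [mul_comm, Complex.star_def, Complex.mul_conj, Complex.normSq_eq_norm_sq]
          push_cast; rfl
        rw [this, star_sum, Finset.sum_mul_sum, Finset.mul_sum]
        refine Finset.sum_congr rfl fun j _ => ?_
        rw [Finset.mul_sum]
        refine Finset.sum_congr rfl fun k _ => ?_
        rw [star_mul']; ring
      simp only [e1]
      rw [Finset.sum_comm]
      rw [hg]; push_cast
      refine Finset.sum_congr rfl fun j hj => ?_
      rw [Finset.sum_comm]
      simp only [← Finset.mul_sum]
      rw [Finset.sum_eq_single_of_mem j hj]
      · rw [hdiag]
        have hpj : (p j : ℂ) ≠ 0 := by exact_mod_cast (hp0 j).ne'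
        simp only [hx, Complex.star_def, map_div₀, Complex.conj_conj, Complex.conj_ofReal]
        have : T a j * (starRingEnd ℂ) (T a j) = ((‖T a j‖ : ℂ)) ^ 2 := by
          rw [Complex.mul_conj, Complex.normSq_eq_norm_sq]; push_cast; rfl
        rw [← this]
        field_simp
      · intro k hk hkj
        rw [hoff j k hkj.symm, mul_zero]
        rw [(Finset.mem_filter.1 hj).2, (Finset.mem_filter.1 hk).2]
    exact_mod_cast hc
  have hle : r a * g ^ 2 ≤ g := by
    calc r a * g ^ 2 = r a * ‖∑ j ∈ S, T a j * x j‖ ^ 2 := by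
          rw [hT, Complex.norm_real, Real.norm_eq_abs, sq_abs]
      _ ≤ ∑ b, r b * ‖∑ j ∈ S, T b j * x j‖ ^ 2 :=
          Finset.single_le_sum (f := fun b => r b * ‖∑ j ∈ S, T b j * x j‖ ^ 2)
            (fun b _ => mul_nonneg (hr b).le (sq_nonneg _)) (Finset.mem_univ a)
      _ = g := hquad
  have : ∑ j ∈ S, r a * ‖T a j‖ ^ 2 / p j = r a * g := by
    rw [hg, Finset.mul_sum]
    exact Finset.sum_congr rfl fun j _ => by ring
  rw [this]
  rcases hg0.eq_or_lt with h | h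
  · rw [← h]; simp
  · by_contra hcon
    push Not at hcon
    nlinarith

theorem lower {L : Type*} [Fintype L] [DecidableEq L] [Nonempty L] (ℓ : m → L)
    (U V : Matrix m m ℂ) (hU : U * Uᴴ = 1) (hV : V * Vᴴ = 1)
    (r s : m → ℝ) (hr : ∀ a, 0 < r a) (hs : ∀ a, 0 < s a) (hr1 : ∑ a, r a = 1)
    (hsl : ∀ x y, ℓ x = ℓ y → s x = s y) :
    ∃ (k : ℕ) (M : Fin k → Matrix m m ℂ), IsPOVM M ∧
      NS U r V s - Real.log (Fintype.card L) ≤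
        measuredRelEnt (conjDiag U r) (conjDiag V s) M := by
  have hU' : Uᴴ * U = 1 := mul_eq_one_comm.1 hU
  have hV' : Vᴴ * V = 1 := mul_eq_one_comm.1 hV
  have hherm : (Vᴴ * conjDiag U r * V).IsHermitian := by
    unfold Matrix.IsHermitian conjDiag
    simp only [Matrix.conjTranspose_mul, Matrix.conjTranspose_conjTranspose,
      Matrix.diagonal_conjTranspose, Matrix.mul_assoc]
    congr 4
    ext i; simp
  obtain ⟨W, hW', hWl, hWoff⟩ := HP2.block_diag_exists ℓ _ hherm
  have hW : W * Wᴴ = 1 := mul_eq_one_comm.1 hW'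
  set E := V * W with hE
  have hEE : E * Eᴴ = 1 := by
    calc E * Eᴴ = V * (W * Wᴴ) * Vᴴ := by simp [hE, Matrix.conjTranspose_mul, Matrix.mul_assoc]
      _ = 1 := by rw [hW]; simp [hV]
  have hEE' : Eᴴ * E = 1 := mul_eq_one_comm.1 hEE
  set T := Uᴴ * E with hT
  set p : m → ℝ := fun j => ∑ a, r a * ‖T a j‖ ^ 2 with hp
  have hTT : Tᴴ * T = 1 := by
    calc Tᴴ * T = Eᴴ * (U * Uᴴ) * E := by simp [hT, Matrix.conjTranspose_mul, Matrix.mul_assoc]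
      _ = 1 := by rw [hU]; simp [hEE']
  have hcol : ∀ j, ∑ a, ‖T a j‖ ^ 2 = 1 := by
    intro j
    rw [← conjT_mul_diag, hTT]; simp
  have hrow : ∀ a, ∑ j, ‖T a j‖ ^ 2 = 1 := sum_row U E hU' hEE
  have hp0 : ∀ j, 0 < p j := by
    intro j
    have hn : ∀ a ∈ Finset.univ, 0 ≤ r a * ‖T a j‖ ^ 2 := fun a _ =>
      mul_nonneg (hr a).le (sq_nonneg _)
    refine (Finset.sum_nonneg hn).lt_of_ne fun h => ?_
    have h1 := (Finset.sum_eq_zero_iff_of_nonneg hn).1 h.symm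
    have h2 : ∑ a, ‖T a j‖ ^ 2 = 0 := Finset.sum_eq_zero fun a ha => by
      rcases mul_eq_zero.1 (h1 a ha) with h | h
      · exact absurd h (hr a).ne'
      · exact h
    rw [hcol] at h2
    exact one_ne_zero h2
  have hTr : Tᴴ * Matrix.diagonal (fun i => (r i : ℂ)) * T = Wᴴ * (Vᴴ * conjDiag U r * V) * W := by
    simp [hT, hE, conjDiag, Matrix.conjTranspose_mul, Matrix.mul_assoc]
  have hoff : ∀ j k, j ≠ k → ℓ j = ℓ k → ∑ a, (r a : ℂ) * (star (T a j) * T a k) = 0 := by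
    intro j k hjk hl
    rw [← conjDiag_diag, hTr]
    exact hWoff j k hjk hl
  -- weights
  have hwt : ∀ a, ∑ j, r a * ‖T a j‖ ^ 2 / p j ≤ Fintype.card L := by
    intro a
    rw [← Finset.sum_fiberwise Finset.univ ℓ]
    calc _ ≤ ∑ l : L, (1 : ℝ) := Finset.sum_le_sum fun l _ =>
          block_weight ℓ T r hr p hp0 (fun j => rfl) hoff a l
      _ = _ := by simp
  set c : ℝ := (Fintype.card L : ℝ) with hc
  have hc0 : 0 < c := by rw [hc]; exact_mod_cast Fintype.card_pos
  -- entropy bound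
  have hent : ∑ a, ∑ j, r a * ‖T a j‖ ^ 2 * (Real.log (r a) - Real.log (p j)) ≤ Real.log c := by
    have hpt : ∀ a j, r a * ‖T a j‖ ^ 2 * (Real.log (r a) - Real.log (p j))
        ≤ r a * (r a * ‖T a j‖ ^ 2 / p j) / c + r a * ‖T a j‖ ^ 2 * (Real.log c - 1) := by
      intro a j
      have h1 := Real.log_le_sub_one_of_pos (x := r a / p j / c)
        (div_pos (div_pos (hr a) (hp0 j)) hc0)
      rw [Real.log_div (div_pos (hr a) (hp0 j)).ne' hc0.ne',
        Real.log_div (hr a).ne' (hp0 j).ne'] at h1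
      have h2 : Real.log (r a) - Real.log (p j) ≤ r a / p j / c + (Real.log c - 1) := by linarith
      calc _ ≤ r a * ‖T a j‖ ^ 2 * (r a / p j / c + (Real.log c - 1)) :=
            mul_le_mul_of_nonneg_left h2 (mul_nonneg (hr a).le (sq_nonneg _))
        _ = _ := by ring
    calc _ ≤ ∑ a, ∑ j, (r a * (r a * ‖T a j‖ ^ 2 / p j) / c
              + r a * ‖T a j‖ ^ 2 * (Real.log c - 1)) :=
          Finset.sum_le_sum fun a _ => Finset.sum_le_sum fun j _ => hpt a j
      _ = ∑ a, (r a * (∑ j, r a * ‖T a j‖ ^ 2 / p j) / c + r a * (Real.log c - 1)) := by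
          refine Finset.sum_congr rfl fun a _ => ?_
          rw [Finset.sum_add_distrib, ← Finset.sum_mul, ← Finset.mul_sum, hrow, mul_one,
            ← Finset.sum_div, ← Finset.mul_sum]
      _ ≤ ∑ a, (r a * c / c + r a * (Real.log c - 1)) := by
          refine Finset.sum_le_sum fun a _ => ?_
          have := hr a
          have := hwt a
          gcongr
      _ = ∑ a, r a * Real.log c := by
          refine Finset.sum_congr rfl fun a _ => ?_
          rw [mul_div_assoc, div_self hc0.ne']; ring
      _ = Real.log c := by rw [← Finset.sum_mul, hr1, one_mul]
  -- the measurement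
  set N : m → Matrix m m ℂ := fun j => E * Matrix.diagonal (Pi.single j 1) * Eᴴ with hN
  have hNps : ∀ j, (N j).PosSemidef := by
    intro j
    have : (Matrix.diagonal (Pi.single j 1 : m → ℂ)).PosSemidef := by
      refine Matrix.PosSemidef.diagonal ?_
      exact Pi.single_nonneg.2 zero_le_one
    exact this.mul_mul_conjTranspose_same E
  have hNsum : ∑ j, N j = 1 := by
    simp only [hN]
    rw [← Finset.sum_mul, ← Finset.mul_sum]
    have : ∑ j, Matrix.diagonal (Pi.single j 1 : m → ℂ) = 1 := by
      ext x y
      rw [Matrix.sum_apply]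
      by_cases hxy : x = y
      · subst hxy
        simp [Pi.single_apply]
      · simp [Matrix.diagonal_apply_ne _ hxy, Matrix.one_apply_ne hxy]
    rw [this]; simp [hEE]
  have hXN : ∀ (X : Matrix m m ℂ) j, (X * N j).trace = (Eᴴ * X * E) j j := by
    intro X j
    have : (X * N j).trace = ((Eᴴ * X * E) * Matrix.diagonal (Pi.single j 1)).trace := by
      simp only [hN]
      rw [← Matrix.mul_assoc, Matrix.trace_mul_comm]
      simp only [Matrix.mul_assoc]
    rw [this, Matrix.trace]
    simp [Matrix.mul_diagonal, Pi.single_apply]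
  have hpN : ∀ j, ((conjDiag U r * N j).trace).re = p j := by
    intro j
    rw [hXN]
    have : Eᴴ * conjDiag U r * E = Tᴴ * Matrix.diagonal (fun i => (r i : ℂ)) * T := by
      simp [hT, conjDiag, Matrix.conjTranspose_mul, Matrix.mul_assoc]
    rw [this, conjDiag_diag, Complex.re_sum]
    refine Finset.sum_congr rfl fun a _ => ?_
    rw [mul_comm (star _), Complex.star_def, Complex.mul_conj, Complex.normSq_eq_norm_sq,
      Complex.re_ofReal_mul, Complex.ofReal_re]
  have hqN : ∀ j, ((conjDiag V s * N j).trace).re = s j := by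
    intro j
    rw [hXN]
    have : Eᴴ * conjDiag V s * E = Matrix.diagonal (fun i => (s i : ℂ)) := by
      calc _ = Wᴴ * (Vᴴ * V) * Matrix.diagonal (fun i => (s i : ℂ)) * (Vᴴ * V) * W := by
            simp [hE, conjDiag, Matrix.conjTranspose_mul, Matrix.mul_assoc]
        _ = Wᴴ * (Matrix.diagonal (fun i => (s i : ℂ)) * W) := by
            rw [hV']; simp [Matrix.mul_assoc]
        _ = _ := by rw [← block_comm ℓ W hWl s hsl, ← Matrix.mul_assoc, hW', one_mul]
    rw [this]; simp
  have hlogs : ∀ a, ∑ b, ‖(Uᴴ * V) a b‖ ^ 2 * Real.log (s b)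
      = ∑ j, ‖T a j‖ ^ 2 * Real.log (s j) := by
    intro a
    have gen : ∀ (X : Matrix m m ℂ) (g : m → ℝ),
        ((X * Matrix.diagonal (fun i => (g i : ℂ)) * Xᴴ) a a).re = ∑ j, ‖X a j‖ ^ 2 * g j := by
      intro X g
      rw [Matrix.mul_apply, Complex.re_sum]
      refine Finset.sum_congr rfl fun j _ => ?_
      rw [Matrix.mul_diagonal, Matrix.conjTranspose_apply, mul_right_comm, Complex.star_def,
        Complex.mul_conj, Complex.normSq_eq_norm_sq, Complex.re_ofReal_mul, Complex.ofReal_re]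
    rw [← gen, ← gen]
    refine congrArg (fun X : Matrix m m ℂ => (X a a).re) ?_
    have hTW : T = (Uᴴ * V) * W := by rw [hT, hE, Matrix.mul_assoc]
    rw [hTW, Matrix.mul_assoc (Uᴴ * V) W,
      block_comm ℓ W hWl (fun i => Real.log (s i)) (fun x y h => by rw [hsl x y h])]
    set Y := Uᴴ * V
    calc _ = Y * Matrix.diagonal (fun i => (Real.log (s i) : ℂ)) * (W * Wᴴ) * Yᴴ := by
          rw [hW]; simp
      _ = _ := by simp only [Matrix.conjTranspose_mul, Matrix.mul_assoc]
  refine ⟨Fintype.card m, fun i => N ((Fintype.equivFin m).symm i), ⟨fun i => hNps _, ?_⟩, ?_⟩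
  · rw [Equiv.sum_comp (Fintype.equivFin m).symm N, hNsum]
  · unfold measuredRelEnt
    rw [Equiv.sum_comp (Fintype.equivFin m).symm (fun j => ((conjDiag U r * N j).trace).re *
      Real.log (((conjDiag U r * N j).trace).re / ((conjDiag V s * N j).trace).re))]
    simp only [hpN, hqN]
    have e1 : ∑ j, p j * Real.log (p j / s j)
        = ∑ a, ∑ j, r a * ‖T a j‖ ^ 2 * (Real.log (p j) - Real.log (s j)) := by
      rw [Finset.sum_comm]
      refine Finset.sum_congr rfl fun j _ => ?_
      rw [Real.log_div (hp0 j).ne' (hs j).ne', ← Finset.sum_mul]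
    have e2 : NS U r V s = ∑ a, ∑ j, r a * ‖T a j‖ ^ 2 * (Real.log (r a) - Real.log (s j)) := by
      unfold NS
      refine Finset.sum_congr rfl fun a _ => ?_
      have h1 : ∀ (X : m → ℝ), ∑ b, r a * X b * (Real.log (r a) - Real.log (s b))
          = r a * Real.log (r a) * ∑ b, X b - r a * ∑ b, X b * Real.log (s b) := by
        intro X
        rw [Finset.mul_sum, Finset.mul_sum, ← Finset.sum_sub_distrib]
        exact Finset.sum_congr rfl fun b _ => by ring
      rw [h1, h1 (fun j => ‖T a j‖ ^ 2), hlogs, hrow, sum_row U V hU' hV]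
    have e3 : NS U r V s - ∑ j, p j * Real.log (p j / s j)
        = ∑ a, ∑ j, r a * ‖T a j‖ ^ 2 * (Real.log (r a) - Real.log (p j)) := by
      rw [e1, e2]
      simp only [← Finset.sum_sub_distrib]
      exact Finset.sum_congr rfl fun a _ => Finset.sum_congr rfl fun b _ => by ring
    linarith

section Tensor
variable {d : ℕ}

lemma tensorPow_mul (A B : Matrix (Fin d) (Fin d) ℂ) (n : ℕ) :
    tensorPow (A * B) n = tensorPow A n * tensorPow B n := by
  ext x y
  simp only [tensorPow, Matrix.mul_apply]
  rw [Fintype.prod_sum]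
  simp only [Finset.prod_mul_distrib]

lemma tensorPow_conjT (A : Matrix (Fin d) (Fin d) ℂ) (n : ℕ) :
    tensorPow Aᴴ n = (tensorPow A n)ᴴ := by
  ext x y
  simp [tensorPow, Matrix.conjTranspose_apply]

lemma tensorPow_diagonal (r : Fin d → ℝ) (n : ℕ) :
    tensorPow (Matrix.diagonal (fun i => (r i : ℂ))) n
      = Matrix.diagonal (fun x : Fin n → Fin d => ((∏ i, r (x i) : ℝ) : ℂ)) := by
  ext x y
  by_cases h : x = y
  · subst h; simp [tensorPow]
  · obtain ⟨i, hi⟩ := Function.ne_iff.1 h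
    rw [Matrix.diagonal_apply_ne _ h]
    exact Finset.prod_eq_zero (Finset.mem_univ i) (Matrix.diagonal_apply_ne _ hi)

lemma tensorPow_one (n : ℕ) :
    tensorPow (1 : Matrix (Fin d) (Fin d) ℂ) n = 1 := by
  have := tensorPow_diagonal (fun _ : Fin d => (1 : ℝ)) n
  simpa using this

lemma tensorPow_conjDiag (U : Matrix (Fin d) (Fin d) ℂ) (r : Fin d → ℝ) (n : ℕ) :
    tensorPow (conjDiag U r) n = conjDiag (tensorPow U n) (fun x => ∏ i, r (x i)) := by
  unfold conjDiag
  rw [tensorPow_mul, tensorPow_mul, tensorPow_conjT, tensorPow_diagonal]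

lemma sum_sum_prod {n : ℕ} (h : Fin n → Fin d → Fin d → ℝ) :
    ∑ x : Fin n → Fin d, ∑ y : Fin n → Fin d, ∏ j, h j (x j) (y j)
      = ∏ j, ∑ a, ∑ b, h j a b := by
  rw [Fintype.prod_sum]
  refine Finset.sum_congr rfl fun x _ => ?_
  rw [Fintype.prod_sum]

lemma sum_additive {n : ℕ} (f g : Fin d → Fin d → ℝ) (hf : ∑ a, ∑ b, f a b = 1) :
    ∑ x : Fin n → Fin d, ∑ y : Fin n → Fin d,
      (∏ j, f (x j) (y j)) * ∑ i, g (x i) (y i) = n * ∑ a, ∑ b, f a b * g a b := by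
  have h1 : ∀ i : Fin n, ∑ x : Fin n → Fin d, ∑ y : Fin n → Fin d,
      (∏ j, f (x j) (y j)) * g (x i) (y i) = ∑ a, ∑ b, f a b * g a b := by
    intro i
    have h2 := sum_sum_prod (n := n) (fun j a b => f a b * (if j = i then g a b else 1))
    simp only [Finset.prod_mul_distrib] at h2
    simp only [Finset.prod_ite_eq', Finset.mem_univ, if_true] at h2
    rw [h2, Finset.prod_eq_single_of_mem i (Finset.mem_univ i)]
    · simp
    · intro j _ hj
      simp [hj, hf]
  simp only [Finset.mul_sum]
  have h3 : ∀ x : Fin n → Fin d, ∑ y : Fin n → Fin d, ∑ i, (∏ j, f (x j) (y j)) * g (x i) (y i)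
      = ∑ i, ∑ y : Fin n → Fin d, (∏ j, f (x j) (y j)) * g (x i) (y i) :=
    fun x => Finset.sum_comm
  simp only [h3]
  rw [Finset.sum_comm]
  simp only [h1, Finset.sum_const, Finset.card_univ, Fintype.card_fin, nsmul_eq_mul]
  simp only [Finset.mul_sum]

lemma NS_tensor (U V : Matrix (Fin d) (Fin d) ℂ) (hU : Uᴴ * U = 1) (hV : V * Vᴴ = 1)
    (r s : Fin d → ℝ) (hr : ∀ a, 0 < r a) (hs : ∀ a, 0 < s a) (hr1 : ∑ a, r a = 1) (n : ℕ) :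
    NS (tensorPow U n) (fun x => ∏ i, r (x i)) (tensorPow V n) (fun x => ∏ i, s (x i))
      = n * NS U r V s := by
  unfold NS
  rw [← sum_additive (n := n) (fun a b => r a * ‖(Uᴴ * V) a b‖ ^ 2)
    (fun a b => Real.log (r a) - Real.log (s b))]
  · refine Finset.sum_congr rfl fun x _ => Finset.sum_congr rfl fun y _ => ?_
    rw [← tensorPow_conjT, ← tensorPow_mul, Real.log_prod (fun i _ => (hr _).ne'),
      Real.log_prod (fun i _ => (hs _).ne'), Finset.prod_mul_distrib, Finset.prod_pow,
      Finset.sum_sub_distrib]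
    congr 3
    simp [tensorPow, norm_prod]
  · simp only [← Finset.mul_sum, sum_row U V hU hV, mul_one, hr1]

/-- The type (empirical counts) of a word. -/
def typ {n : ℕ} (x : Fin n → Fin d) : Fin d → Fin (n + 1) := fun a =>
  ⟨(Finset.univ.filter fun i => x i = a).card, by
    have := Finset.card_filter_le (Finset.univ : Finset (Fin n)) (fun i => x i = a)
    simp at this; omega⟩

lemma typ_prod {n : ℕ} (s : Fin d → ℝ) (x y : Fin n → Fin d) (h : typ x = typ y) :
    ∏ i, s (x i) = ∏ i, s (y i) := by
  have key : ∀ x : Fin n → Fin d, ∏ i, s (x i) = ∏ a, s a ^ ((typ x a : Fin (n + 1)) : ℕ) := by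
    intro x
    rw [← Finset.prod_fiberwise Finset.univ x]
    refine Finset.prod_congr rfl fun a _ => ?_
    rw [Finset.prod_congr rfl (g := fun _ => s a), Finset.prod_const]
    · rfl
    · intro i hi
      rw [(Finset.mem_filter.1 hi).2]
  rw [key, key, h]

end Tensor

lemma relEnt_eq (A B : Matrix m m ℂ) (hA : A.IsHermitian) (hB : B.IsHermitian) :
    A = conjDiag (hA.eigenvectorUnitary : Matrix m m ℂ) hA.eigenvalues ∧
    relEnt A B = NS (hA.eigenvectorUnitary : Matrix m m ℂ) hA.eigenvalues
      (hB.eigenvectorUnitary : Matrix m m ℂ) hB.eigenvalues := by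
  have h1 : A = conjDiag (hA.eigenvectorUnitary : Matrix m m ℂ) hA.eigenvalues := by
    have h := hA.spectral_theorem
    rw [Unitary.conjStarAlgAut_apply] at h
    exact h
  refine ⟨h1, ?_⟩
  have hU : (hA.eigenvectorUnitary : Matrix m m ℂ)ᴴ * (hA.eigenvectorUnitary : Matrix m m ℂ) = 1 :=
    Unitary.coe_star_mul_self hA.eigenvectorUnitary
  have hV : (hB.eigenvectorUnitary : Matrix m m ℂ)ᴴ * (hB.eigenvectorUnitary : Matrix m m ℂ) = 1 :=
    Unitary.coe_star_mul_self hB.eigenvectorUnitary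
  have hV' := mul_eq_one_comm.1 hV
  have hLA : matLog A = conjDiag (hA.eigenvectorUnitary : Matrix m m ℂ)
      (fun i => Real.log (hA.eigenvalues i)) := by
    unfold matLog matFun; rw [dif_pos hA]; rfl
  have hLB : matLog B = conjDiag (hB.eigenvectorUnitary : Matrix m m ℂ)
      (fun i => Real.log (hB.eigenvalues i)) := by
    unfold matLog matFun; rw [dif_pos hB]; rfl
  unfold relEnt
  rw [hLA, hLB]
  generalize (hA.eigenvectorUnitary : Matrix m m ℂ) = U at *
  generalize (hB.eigenvectorUnitary : Matrix m m ℂ) = V at *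
  generalize hA.eigenvalues = r at *
  generalize hB.eigenvalues = s at *
  rw [h1, tr_conjDiag]
  unfold NS
  refine Finset.sum_congr rfl fun a _ => ?_
  have e1 : Uᴴ * conjDiag U (fun i => Real.log (r i)) * U
      = Matrix.diagonal (fun i => (Real.log (r i) : ℂ)) := by
    calc _ = (Uᴴ * U) * Matrix.diagonal (fun i => (Real.log (r i) : ℂ)) * (Uᴴ * U) := by
          simp only [conjDiag, Matrix.mul_assoc]
      _ = _ := by rw [hU]; simp
  have e2 : Uᴴ * conjDiag V (fun i => Real.log (s i)) * U
      = (Uᴴ * V) * Matrix.diagonal (fun i => (Real.log (s i) : ℂ)) * (Uᴴ * V)ᴴ := by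
    simp [conjDiag, Matrix.conjTranspose_mul, Matrix.mul_assoc]
  have e3 : ((Uᴴ * V * Matrix.diagonal (fun i => (Real.log (s i) : ℂ)) * (Uᴴ * V)ᴴ) a a).re
      = ∑ b, ‖(Uᴴ * V) a b‖ ^ 2 * Real.log (s b) := by
    rw [Matrix.mul_apply, Complex.re_sum]
    refine Finset.sum_congr rfl fun j _ => ?_
    rw [Matrix.mul_diagonal, Matrix.conjTranspose_apply, mul_right_comm, Complex.star_def,
      Complex.mul_conj, Complex.normSq_eq_norm_sq, Complex.re_ofReal_mul, Complex.ofReal_re]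
  rw [Matrix.mul_sub, Matrix.sub_mul, Matrix.sub_apply, Complex.sub_re, e1, e2, e3,
    Matrix.diagonal_apply_eq, Complex.ofReal_re]
  have h4 : ∑ b, r a * ‖(Uᴴ * V) a b‖ ^ 2 * (Real.log (r a) - Real.log (s b))
      = r a * Real.log (r a) * (∑ b, ‖(Uᴴ * V) a b‖ ^ 2)
        - r a * ∑ b, ‖(Uᴴ * V) a b‖ ^ 2 * Real.log (s b) := by
    rw [Finset.mul_sum, Finset.mul_sum, ← Finset.sum_sub_distrib]
    exact Finset.sum_congr rfl fun b _ => by ring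
  rw [h4, sum_row U V hU hV']
  ring

end HP

/-- **Hiai–Petz theorem.** `D(ρ‖σ) = lim_{n→∞} (1/n) sup_{M_n} D_{M_n}(ρ_n‖σ_n)`,
the supremum running over all POVMs on the `d^n`-dimensional space. -/
theorem hiai_petz {d : ℕ} (hd : 0 < d) (ρ σ : Matrix (Fin d) (Fin d) ℂ)
    (hρ : IsDensity ρ) (hσ : IsDensity σ) (hρpd : ρ.PosDef) (hσpd : σ.PosDef) :
    Tendsto (fun n : ℕ => (1 / (n : ℝ)) *
        (⨆ (k : ℕ) (M : Fin k → Matrix (Fin n → Fin d) (Fin n → Fin d) ℂ)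
          (_ : IsPOVM M), measuredRelEnt (tensorPow ρ n) (tensorPow σ n) M))
      atTop (nhds (relEnt ρ σ)) := by
  have hA := hρpd.1
  have hB := hσpd.1
  obtain ⟨hρe, hrel⟩ := HP.relEnt_eq ρ σ hA hB
  obtain ⟨hσe, -⟩ := HP.relEnt_eq σ ρ hB hA
  have hU : (hA.eigenvectorUnitary : Matrix (Fin d) (Fin d) ℂ)ᴴ
      * (hA.eigenvectorUnitary : Matrix (Fin d) (Fin d) ℂ) = 1 :=
    Unitary.coe_star_mul_self hA.eigenvectorUnitary
  have hV : (hB.eigenvectorUnitary : Matrix (Fin d) (Fin d) ℂ)ᴴ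
      * (hB.eigenvectorUnitary : Matrix (Fin d) (Fin d) ℂ) = 1 :=
    Unitary.coe_star_mul_self hB.eigenvectorUnitary
  have hr : ∀ a, 0 < hA.eigenvalues a := fun a => hρpd.eigenvalues_pos a
  have hs : ∀ a, 0 < hB.eigenvalues a := fun a => hσpd.eigenvalues_pos a
  have hr1 : ∑ a, hA.eigenvalues a = 1 := by
    rw [← HP.conjDiag_trace _ hU, ← hρe, hρ.2]; simp
  rw [hrel]
  clear hrel
  generalize (hA.eigenvectorUnitary : Matrix (Fin d) (Fin d) ℂ) = U at *
  generalize (hB.eigenvectorUnitary : Matrix (Fin d) (Fin d) ℂ) = V at *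
  generalize hA.eigenvalues = r at *
  generalize hB.eigenvalues = s at *
  have hU' : U * Uᴴ = 1 := mul_eq_one_comm.1 hU
  have hV' : V * Vᴴ = 1 := mul_eq_one_comm.1 hV
  have hUn : ∀ n, tensorPow U n * (tensorPow U n)ᴴ = 1 := fun n => by
    rw [← HP.tensorPow_conjT, ← HP.tensorPow_mul, hU', HP.tensorPow_one]
  have hVn : ∀ n, tensorPow V n * (tensorPow V n)ᴴ = 1 := fun n => by
    rw [← HP.tensorPow_conjT, ← HP.tensorPow_mul, hV', HP.tensorPow_one]
  have hrn : ∀ n, ∀ x : Fin n → Fin d, 0 < ∏ i, r (x i) := fun n x =>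
    Finset.prod_pos fun i _ => hr _
  have hsn : ∀ n, ∀ x : Fin n → Fin d, 0 < ∏ i, s (x i) := fun n x =>
    Finset.prod_pos fun i _ => hs _
  have hr1n : ∀ n, ∑ x : Fin n → Fin d, ∏ i, r (x i) = 1 := fun n => by
    rw [← Fintype.prod_sum (fun (_ : Fin n) a => r a)]; simp [hr1]
  set D := HP.NS U r V s with hD
  have hup : ∀ n (k : ℕ) (M : Fin k → Matrix (Fin n → Fin d) (Fin n → Fin d) ℂ), IsPOVM M →
      measuredRelEnt (tensorPow ρ n) (tensorPow σ n) M ≤ n * D := by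
    intro n k M hM
    rw [hρe, hσe, HP.tensorPow_conjDiag, HP.tensorPow_conjDiag, hD,
      ← HP.NS_tensor U V hU hV' r s hr hs hr1]
    exact HP.upper _ _ (hUn n) (hVn n) _ _ (hrn n) (hsn n) (hr1n n) M hM
  have hlow : ∀ n, ∃ (k : ℕ) (M : Fin k → Matrix (Fin n → Fin d) (Fin n → Fin d) ℂ), IsPOVM M ∧
      n * D - d * Real.log (n + 1) ≤ measuredRelEnt (tensorPow ρ n) (tensorPow σ n) M := by
    intro n
    rw [hρe, hσe, HP.tensorPow_conjDiag, HP.tensorPow_conjDiag, hD,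
      ← HP.NS_tensor U V hU hV' r s hr hs hr1]
    obtain ⟨k, M, hM, h⟩ := HP.lower (HP.typ (d := d) (n := n)) _ _ (hUn n) (hVn n) _ _ (hrn n)
      (hsn n) (hr1n n) (fun x y h => HP.typ_prod s x y h)
    refine ⟨k, M, hM, le_trans (le_of_eq ?_) h⟩
    simp
  have hD0 : ∀ n : ℕ, 0 ≤ n * D := by
    intro n
    have h1 : IsPOVM (fun _ : Fin 1 => (1 : Matrix (Fin n → Fin d) (Fin n → Fin d) ℂ)) :=
      ⟨fun _ => Matrix.PosSemidef.one, by simp⟩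
    refine le_trans (le_of_eq ?_) (hup n 1 _ h1)
    have t : ∀ (τ W : Matrix (Fin d) (Fin d) ℂ), τ.trace = 1 → (tensorPow τ n).trace = 1 := by
      intro τ W hτ
      rw [Matrix.trace]
      simp only [Matrix.diag_apply, tensorPow]
      rw [← Fintype.prod_sum (fun (_ : Fin n) a => τ a a)]
      have : ∑ a, τ a a = 1 := hτ
      simp [this]
    simp [measuredRelEnt, t ρ ρ hρ.2, t σ σ hσ.2]
  have b1 : ∀ n (k : ℕ) (M : Fin k → Matrix (Fin n → Fin d) (Fin n → Fin d) ℂ),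
      (⨆ (_ : IsPOVM M), measuredRelEnt (tensorPow ρ n) (tensorPow σ n) M) ≤ n * D :=
    fun n k M => Real.iSup_le (fun h => hup n k M h) (hD0 n)
  have b2 : ∀ n (k : ℕ), (⨆ (M : Fin k → Matrix (Fin n → Fin d) (Fin n → Fin d) ℂ)
      (_ : IsPOVM M), measuredRelEnt (tensorPow ρ n) (tensorPow σ n) M) ≤ n * D :=
    fun n k => Real.iSup_le (fun M => b1 n k M) (hD0 n)
  have b3 : ∀ n : ℕ, (⨆ (k : ℕ) (M : Fin k → Matrix (Fin n → Fin d) (Fin n → Fin d) ℂ)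
      (_ : IsPOVM M), measuredRelEnt (tensorPow ρ n) (tensorPow σ n) M) ≤ n * D :=
    fun n => Real.iSup_le (fun k => b2 n k) (hD0 n)
  have b4 : ∀ n : ℕ, n * D - d * Real.log (n + 1) ≤
      (⨆ (k : ℕ) (M : Fin k → Matrix (Fin n → Fin d) (Fin n → Fin d) ℂ)
      (_ : IsPOVM M), measuredRelEnt (tensorPow ρ n) (tensorPow σ n) M) := by
    intro n
    obtain ⟨k, M, hM, h⟩ := hlow n
    refine h.trans ?_
    refine le_trans ?_ (le_ciSup (f := fun k : ℕ =>
      ⨆ (M : Fin k → Matrix (Fin n → Fin d) (Fin n → Fin d) ℂ)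
      (_ : IsPOVM M), measuredRelEnt (tensorPow ρ n) (tensorPow σ n) M)
      ⟨n * D, by rintro _ ⟨k, rfl⟩; exact b2 n k⟩ k)
    refine le_trans ?_ (le_ciSup (f := fun M : Fin k → Matrix (Fin n → Fin d) (Fin n → Fin d) ℂ =>
      ⨆ (_ : IsPOVM M), measuredRelEnt (tensorPow ρ n) (tensorPow σ n) M)
      ⟨n * D, by rintro _ ⟨k, rfl⟩; exact b1 n _ k⟩ M)
    rw [ciSup_pos hM]
  have hlog : Tendsto (fun n : ℕ => D - d * (Real.log (n + 1) / n)) atTop (nhds D) := by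
    have h1 : Tendsto (fun x : ℝ => Real.log x / x) atTop (nhds 0) :=
      Real.isLittleO_log_id_atTop.tendsto_div_nhds_zero
    have h2 : Tendsto (fun n : ℕ => (n : ℝ) + 1) atTop atTop :=
      tendsto_atTop_add_const_right _ _ tendsto_natCast_atTop_atTop
    have h3 := h1.comp h2
    have h4 : Tendsto (fun n : ℕ => 1 + 1 / (n : ℝ)) atTop (nhds (1 + 0)) :=
      tendsto_const_nhds.add tendsto_one_div_atTop_nhds_zero_nat
    have h5 := ((h3.mul h4).const_mul (d : ℝ)).const_sub D
    simp only [zero_mul, mul_zero, sub_zero] at h5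
    refine h5.congr' ?_
    filter_upwards [eventually_gt_atTop 0] with n hn
    have hn' : (0 : ℝ) < n := by exact_mod_cast hn
    simp only [Function.comp]
    field_simp
  refine tendsto_of_tendsto_of_tendsto_of_le_of_le' hlog tendsto_const_nhds ?_ ?_
  · filter_upwards [eventually_gt_atTop 0] with n hn
    have hn' : (0 : ℝ) < n := by exact_mod_cast hn
    have := mul_le_mul_of_nonneg_left (b4 n) (by positivity : 0 ≤ 1 / (n : ℝ))
    refine le_trans (le_of_eq ?_) this
    field_simp
  · filter_upwards [eventually_gt_atTop 0] with n hn
    have hn' : (0 : ℝ) < n := by exact_mod_cast hn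
    have := mul_le_mul_of_nonneg_left (b3 n) (by positivity : 0 ≤ 1 / (n : ℝ))
    refine this.trans (le_of_eq ?_)
    field_simp

end
end
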